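/- Let {Γ_t}, t ∈ [0,T), be a curve shortening flow of simple closed curves on the unit sphere S² ⊂ ℝ³ with T < ∞ and total length L(t) satisfying L(t) → 0 as t → T, and suppose that at t = 0 there exists a > 0 such that d(x,y)/L(0) ≥ a⁻¹ arctan((a/π) sin(π ℓ(x,y,0)/L(0))) for all x, y ∈ Γ₀. Then for all t ∈ [0,T), 2π √(1 − e^{−2(T−t)}) ≤ L(t) ≤ 2π √((1 + 2a²/π²)(1 − e^{−2(T−t)})). -/

import Mathlib

open Real MeasureTheory

noncomputable section

/-- Arclength derivative `∂_s f = |∂_u γ|⁻¹ ∂_u f` along the family of curves `u ↦ γ u t`. -/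
def pS (γ f : ℝ → ℝ → EuclideanSpace ℝ (Fin 3)) (u t : ℝ) : EuclideanSpace ℝ (Fin 3) :=
  ‖deriv (fun v => γ v t) u‖⁻¹ • deriv (fun v => f v t) u

/-- The geodesic curvature vector `∂_s²γ + γ` of the spherical curve `u ↦ γ u t`. -/
def curvVec (γ : ℝ → ℝ → EuclideanSpace ℝ (Fin 3)) (u t : ℝ) : EuclideanSpace ℝ (Fin 3) :=
  pS γ (pS γ γ) u t + γ u t

/-- A curve shortening flow `∂_t γ = ∂_s²γ + γ` of simple closed curves on the unit sphere
`S² ⊂ ℝ³`, defined for times `t` in the set `D` (each `γ(·,t)` is a `2π`-periodic regular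
parametrisation, injective on a period, of a simple closed spherical curve `Γ_t`). -/
structure SphereCSF (D : Set ℝ) where
  γ : ℝ → ℝ → EuclideanSpace ℝ (Fin 3)
  smooth : ContDiffOn ℝ (⊤ : ℕ∞) (fun p : ℝ × ℝ => γ p.1 p.2) (Set.univ ×ˢ D)
  spherical : ∀ t ∈ D, ∀ u, ‖γ u t‖ = 1
  periodic : ∀ t ∈ D, Function.Periodic (fun u => γ u t) (2 * π)
  regular : ∀ t ∈ D, ∀ u, deriv (fun v => γ v t) u ≠ 0
  simple : ∀ t ∈ D, Set.InjOn (fun u => γ u t) (Set.Ico 0 (2 * π))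
  flow : ∀ t ∈ D, ∀ u, HasDerivWithinAt (fun s => γ u s) (curvVec γ u t) D t

variable {D : Set ℝ}

/-- The parametrisation speed `|∂_u γ|`. -/
def SphereCSF.speed (F : SphereCSF D) (u t : ℝ) : ℝ := ‖deriv (fun v => F.γ v t) u‖

/-- The total length `L(t)` of the curve `Γ_t`. -/
def SphereCSF.length (F : SphereCSF D) (t : ℝ) : ℝ := ∫ u in (0:ℝ)..(2 * π), F.speed u t

/-- The length `ℓ` of the shorter of the two arcs of `Γ_t` joining `γ(u,t)` to `γ(v,t)`. -/
def SphereCSF.arcLen (F : SphereCSF D) (t u v : ℝ) : ℝ :=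
  min |∫ w in u..v, F.speed w t| (F.length t - |∫ w in u..v, F.speed w t|)

/-- The Euclidean chord length `d` between `γ(u,t)` and `γ(v,t)`. -/
def SphereCSF.chord (F : SphereCSF D) (t u v : ℝ) : ℝ := ‖F.γ u t - F.γ v t‖

/-- The squared geodesic curvature `κ² = |∂_s²γ + γ|²`. -/
def SphereCSF.curvSq (F : SphereCSF D) (u t : ℝ) : ℝ := ‖curvVec F.γ u t‖ ^ 2

/-- The rescaled time `τ(t) = ∫₀ᵗ L(s)⁻² ds`. -/
def SphereCSF.tau (F : SphereCSF D) (t : ℝ) : ℝ := ∫ s in (0:ℝ)..t, ((F.length s) ^ 2)⁻¹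

/-! ### The comparison profile -/

lemma apply_zero_le_of_hasDerivAt_nonneg {f f' : ℝ → ℝ} {x : ℝ} (hx : 0 ≤ x)
    (hf : ∀ y ∈ Set.Icc 0 x, HasDerivAt f (f' y) y) (hf' : ∀ y ∈ Set.Icc 0 x, 0 ≤ f' y) :
    f 0 ≤ f x := by
  have hmono : MonotoneOn f (Set.Icc 0 x) := by
    refine monotoneOn_of_hasDerivWithinAt_nonneg (f' := f') (convex_Icc 0 x)
      (fun y hy => (hf y hy).continuousAt.continuousWithinAt) (fun y hy => ?_) (fun y hy => ?_)
    · exact (hf y (interior_subset hy)).hasDerivWithinAt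
    · exact hf' y (interior_subset hy)
  exact hmono ⟨le_rfl, hx⟩ ⟨hx, le_rfl⟩ hx

lemma arctan_le_self_of_nonneg {z : ℝ} (hz : 0 ≤ z) : arctan z ≤ z := by
  have := apply_zero_le_of_hasDerivAt_nonneg (f := fun z => z - arctan z) hz
    (fun y _ => (hasDerivAt_id y).sub (hasDerivAt_arctan y)) (fun y _ => by
      have : 1 / (1 + y ^ 2) ≤ 1 := by
        rw [div_le_one (by positivity)]; nlinarith [sq_nonneg y]
      linarith)
  simp only [arctan_zero, sub_zero] at this
  linarith

lemma div_one_add_sq_le_arctan {z : ℝ} (hz : 0 ≤ z) : z / (1 + z ^ 2) ≤ arctan z := by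
  have := apply_zero_le_of_hasDerivAt_nonneg (f := fun z => arctan z - z / (1 + z ^ 2)) hz
    (fun y _ => (hasDerivAt_arctan y).sub ((hasDerivAt_id' y).div
      (((hasDerivAt_id' y).pow 2).const_add 1)
      (show 1 + y ^ 2 ≠ 0 by positivity)))
    (fun y _ => by
      have h : (1 + y ^ 2) ≠ 0 := by positivity
      have : 1 / (1 + y ^ 2) - (1 * (1 + y ^ 2) - y * (2 * y)) / (1 + y ^ 2) ^ 2
          = 2 * y ^ 2 / (1 + y ^ 2) ^ 2 := by field_simp; ring
      simp only [Nat.cast_ofNat, Nat.add_one_sub_one, pow_one, mul_one, Pi.pow_apply] 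
      rw [this]; positivity)
  simp only [arctan_zero, zero_div, sub_zero] at this
  linarith

lemma sub_cube_div_three_le_arctan {z : ℝ} (hz : 0 ≤ z) : z - z ^ 3 / 3 ≤ arctan z := by
  have := apply_zero_le_of_hasDerivAt_nonneg (f := fun z => arctan z - (z - z ^ 3 / 3)) hz
    (fun y _ => (hasDerivAt_arctan y).sub ((hasDerivAt_id y).sub
      (((hasDerivAt_id y).pow 3).div_const 3)))
    (fun y _ => by
      have h : (1 + y ^ 2) ≠ 0 := by positivity
      have : 1 / (1 + y ^ 2) - (1 - 3 * y ^ 2 / 3) = y ^ 4 / (1 + y ^ 2) := by field_simp; ring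
      simp only [id, Nat.cast_ofNat, mul_one, Nat.add_one_sub_one] at this ⊢
      rw [this]; positivity)
  simp only [arctan_zero] at this
  linarith

/-- The profile `σ ↦ a⁻¹ arctan((a/π) sin(πσ))` of the chord-arc estimate. -/
def chordProfile (a σ : ℝ) : ℝ := a⁻¹ * arctan (a / π * sin (π * σ))

/-- The first derivative of `chordProfile`. -/
def chordProfileDeriv (a σ : ℝ) : ℝ := cos (π * σ) / (1 + (a / π * sin (π * σ)) ^ 2)

/-- The second derivative of `chordProfile`. -/
def chordProfileDerivTwo (a σ : ℝ) : ℝ :=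
  -(π * sin (π * σ) * (1 + 2 * (a / π) ^ 2 - (a / π * sin (π * σ)) ^ 2))
    / (1 + (a / π * sin (π * σ)) ^ 2) ^ 2

lemma hasDerivAt_mul_sin_pi_mul (k σ : ℝ) :
    HasDerivAt (fun σ => k * sin (π * σ)) (k * (cos (π * σ) * π)) σ := by
  have := ((hasDerivAt_sin (π * σ)).comp σ ((hasDerivAt_id σ).const_mul π)).const_mul k
  simpa using this

lemma hasDerivAt_chordProfile {a : ℝ} (ha : 0 < a) (σ : ℝ) :
    HasDerivAt (chordProfile a) (chordProfileDeriv a σ) σ := by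
  have h := ((hasDerivAt_arctan (a / π * sin (π * σ))).comp σ
    (hasDerivAt_mul_sin_pi_mul (a / π) σ)).const_mul a⁻¹
  refine h.congr_deriv ?_
  unfold chordProfileDeriv
  have : (1 + (a / π * sin (π * σ)) ^ 2) ≠ 0 := by positivity
  field_simp

lemma hasDerivAt_chordProfileDeriv {a : ℝ} (σ : ℝ) :
    HasDerivAt (chordProfileDeriv a) (chordProfileDerivTwo a σ) σ := by
  have hc : HasDerivAt (fun σ => cos (π * σ)) (-sin (π * σ) * π) σ := by
    have := (hasDerivAt_cos (π * σ)).comp σ ((hasDerivAt_id σ).const_mul π)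
    rw [mul_one] at this
    exact this
  have hne : (1 + (a / π * sin (π * σ)) ^ 2) ≠ 0 := by positivity
  have h := hc.div (((hasDerivAt_mul_sin_pi_mul (a / π) σ).pow 2).const_add 1) hne
  refine h.congr_deriv ?_
  unfold chordProfileDerivTwo
  simp only [Pi.pow_apply]
  congr 1
  have hs : cos (π * σ) ^ 2 = 1 - sin (π * σ) ^ 2 := by rw [cos_sq']
  norm_num
  linear_combination (-(2 * (a / π) ^ 2 * π * sin (π * σ))) * hs

lemma chordProfile_one_sub (a σ : ℝ) : chordProfile a (1 - σ) = chordProfile a σ := by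
  unfold chordProfile
  rw [mul_sub, mul_one, sin_pi_sub]

lemma sin_pi_mul_nonneg {σ : ℝ} (h0 : 0 ≤ σ) (h1 : σ ≤ 1) : 0 ≤ sin (π * σ) :=
  sin_nonneg_of_nonneg_of_le_pi (by positivity) (by nlinarith [pi_pos])

lemma chordProfile_pos {a σ : ℝ} (ha : 0 < a) (h0 : 0 < σ) (h1 : σ < 1) :
    0 < chordProfile a σ := by
  have hs : 0 < sin (π * σ) := sin_pos_of_pos_of_lt_pi (by positivity) (by nlinarith [pi_pos])
  unfold chordProfile
  have : 0 < arctan (a / π * sin (π * σ)) := by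
    rw [← arctan_zero]; exact arctan_strictMono (by positivity)
  positivity

lemma chordProfile_le_self {a σ : ℝ} (ha : 0 < a) (h0 : 0 ≤ σ) (h1 : σ ≤ 1) :
    chordProfile a σ ≤ σ := by
  have hs := sin_pi_mul_nonneg h0 h1
  have h2 : sin (π * σ) ≤ π * σ := sin_le (by positivity)
  have h3 : arctan (a / π * sin (π * σ)) ≤ a * σ := by
    refine (arctan_le_self_of_nonneg (by positivity)).trans ?_
    calc a / π * sin (π * σ) ≤ a / π * (π * σ) := by gcongr
      _ = a * σ := by field_simp
  unfold chordProfile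
  calc a⁻¹ * arctan (a / π * sin (π * σ)) ≤ a⁻¹ * (a * σ) := by gcongr
    _ = σ := by field_simp

lemma sub_cube_le_chordProfile {a σ : ℝ} (ha : 0 < a) (h0 : 0 ≤ σ) (h1 : σ ≤ 1) :
    σ - (π ^ 2 + 2 * a ^ 2) / 6 * σ ^ 3 ≤ chordProfile a σ := by
  have hs := sin_pi_mul_nonneg h0 h1
  have h2 : sin (π * σ) ≤ π * σ := sin_le (by positivity)
  have h4 : π * σ - (π * σ) ^ 3 / 6 ≤ sin (π * σ) := sin_ge_sub_cube (by positivity)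
  set z := a / π * sin (π * σ) with hz
  have hz0 : 0 ≤ z := by positivity
  have hz1 : z ≤ a * σ := by
    calc a / π * sin (π * σ) ≤ a / π * (π * σ) := by gcongr
      _ = a * σ := by field_simp
  have hz2 : a * (σ - π ^ 2 * σ ^ 3 / 6) ≤ z := by
    calc a * (σ - π ^ 2 * σ ^ 3 / 6) = a / π * (π * σ - (π * σ) ^ 3 / 6) := by field_simp
      _ ≤ _ := by rw [hz]; gcongr
  have h3 := sub_cube_div_three_le_arctan hz0
  have hz3 : z ^ 3 ≤ (a * σ) ^ 3 := by gcongr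
  unfold chordProfile
  rw [← hz]
  calc σ - (π ^ 2 + 2 * a ^ 2) / 6 * σ ^ 3
      = a⁻¹ * (a * (σ - π ^ 2 * σ ^ 3 / 6) - (a * σ) ^ 3 / 3) := by field_simp; ring
    _ ≤ a⁻¹ * arctan z := by gcongr; linarith

lemma cos_pi_mul_nonneg {σ : ℝ} (h0 : 0 ≤ σ) (h1 : σ ≤ 1 / 2) : 0 ≤ cos (π * σ) :=
  cos_nonneg_of_mem_Icc ⟨by nlinarith [pi_pos], by nlinarith [pi_pos]⟩

lemma chordProfileDeriv_nonneg {a σ : ℝ} (h0 : 0 ≤ σ) (h1 : σ ≤ 1 / 2) :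
    0 ≤ chordProfileDeriv a σ := by
  have := cos_pi_mul_nonneg h0 h1
  unfold chordProfileDeriv
  positivity

lemma chordProfileDeriv_le_cos {a σ : ℝ} (h0 : 0 ≤ σ) (h1 : σ ≤ 1 / 2) :
    chordProfileDeriv a σ ≤ cos (π * σ) :=
  div_le_self (cos_pi_mul_nonneg h0 h1) (by nlinarith [sq_nonneg (a / π * sin (π * σ))])

lemma mul_cos_le_sin {α : ℝ} (h0 : 0 ≤ α) (h1 : α ≤ π / 2) : α * cos α ≤ sin α := by
  rcases h1.eq_or_lt with rfl | h1
  · simp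
  · have hc : 0 < cos α := cos_pos_of_mem_Ioo ⟨by linarith [pi_pos], h1⟩
    have := le_tan h0 h1
    rw [tan_eq_sin_div_cos, le_div_iff₀ hc] at this
    exact this

lemma mul_chordProfileDeriv_le_chordProfile {a σ : ℝ} (ha : 0 < a) (h0 : 0 ≤ σ)
    (h1 : σ ≤ 1 / 2) : σ * chordProfileDeriv a σ ≤ chordProfile a σ := by
  have hs := sin_pi_mul_nonneg h0 (by linarith)
  have hz := div_one_add_sq_le_arctan (z := a / π * sin (π * σ)) (by positivity)
  have hm := mul_cos_le_sin (α := π * σ) (by positivity) (by nlinarith [pi_pos])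
  unfold chordProfile chordProfileDeriv
  calc σ * (cos (π * σ) / (1 + (a / π * sin (π * σ)) ^ 2))
      = π⁻¹ * (π * σ * cos (π * σ)) / (1 + (a / π * sin (π * σ)) ^ 2) := by field_simp
    _ ≤ π⁻¹ * sin (π * σ) / (1 + (a / π * sin (π * σ)) ^ 2) := by gcongr
    _ = a⁻¹ * (a / π * sin (π * σ) / (1 + (a / π * sin (π * σ)) ^ 2)) := by field_simp
    _ ≤ _ := by gcongr

/-- `θ² − α² ≥ (2α / sin α)(cos α − cos θ)`, since `x / sin x` is increasing. -/
lemma mul_cos_sub_cos_le {α θ : ℝ} (h0 : 0 < α) (h1 : α ≤ θ) (h2 : θ ≤ π / 2) :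
    2 * α * (cos α - cos θ) ≤ (θ ^ 2 - α ^ 2) * sin α := by
  have hcross : ∀ x ∈ Set.Icc α θ, α * sin x ≤ x * sin α := by
    intro x hx
    have hx' : x ∈ Set.Icc 0 π := ⟨h0.le.trans hx.1, by linarith [hx.2, pi_pos]⟩
    have hx0 : 0 < x := h0.trans_le hx.1
    have := strictConcaveOn_sin_Icc.concaveOn.2 (show (0 : ℝ) ∈ Set.Icc 0 π from ⟨le_rfl, pi_pos.le⟩)
      hx' (show 0 ≤ 1 - α / x by rw [sub_nonneg, div_le_one hx0]; exact hx.1)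
      (show 0 ≤ α / x by positivity) (by ring)
    simp only [smul_eq_mul, sin_zero, mul_zero, zero_add] at this
    rw [div_mul_cancel₀ _ hx0.ne', div_mul_eq_mul_div, div_le_iff₀ hx0] at this
    linarith
  have hd : ∀ y ∈ Set.Icc 0 (θ - α), HasDerivAt
      (fun y => (α + y) ^ 2 * sin α + 2 * α * cos (α + y))
      (2 * (α + y) * sin α + 2 * α * (-sin (α + y))) y := by
    intro y _
    have h := (hasDerivAt_id y).const_add α
    exact (((h.pow 2).mul_const (sin α)).add
      (((hasDerivAt_cos (α + y)).comp y h).const_mul (2 * α))).congr_deriv (by simp)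
  have := apply_zero_le_of_hasDerivAt_nonneg (by linarith) hd (fun y hy => by
    have := hcross (α + y) ⟨by linarith [hy.1], by linarith [hy.2]⟩
    nlinarith)
  simp only [add_zero, add_sub_cancel] at this
  nlinarith

/-- The differential inequality satisfied by (contractions of) the comparison profile. -/
lemma chordProfile_differential_ineq {a μ σ : ℝ} (ha : 0 < a) (hμ0 : 0 ≤ μ) (hμ1 : μ ≤ 1)
    (h0 : 0 < σ) (h1 : σ ≤ 1 / 2) :
    0 ≤ μ * chordProfileDerivTwo a σ
      + π ^ 2 * (μ * chordProfile a σ - σ * (μ * chordProfileDeriv a σ))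
      + μ * chordProfileDeriv a σ * arccos (μ * chordProfileDeriv a σ) ^ 2 / σ := by
  have hc := cos_pi_mul_nonneg h0.le h1
  have hs : 0 < sin (π * σ) := sin_pos_of_pos_of_lt_pi (by positivity) (by nlinarith [pi_pos])
  have hp := chordProfileDeriv_nonneg (a := a) h0.le h1
  have hpc := chordProfileDeriv_le_cos (a := a) h0.le h1
  have hα2 : π * σ ≤ π / 2 := by nlinarith [pi_pos]
  have hα : 0 < π * σ := by positivity
  set p := chordProfileDeriv a σ with hpdef
  set α := π * σ with hαdef
  have hp1 : p ≤ 1 := hpc.trans (cos_le_one _)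
  set θ := arccos p with hθ
  have hcosθ : cos θ = p := cos_arccos (by linarith) hp1
  have hαθ : α ≤ θ := by
    rw [hθ, ← arccos_cos hα.le (by linarith [pi_pos])]
    exact antitone_arccos hpc
  have hθ2 : θ ≤ π / 2 := arccos_le_pi_div_two.2 hp
  have hθμ : θ ≤ arccos (μ * p) := antitone_arccos (by nlinarith)
  have key := mul_cos_sub_cos_le hα hαθ hθ2
  rw [hcosθ] at key
  set k := a / π with hk
  have hk0 : 0 < k := by positivity
  set s := sin α with hsdef
  set c := cos α with hcdef
  have hpe : p = c / (1 + (k * s) ^ 2) := rfl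
  have hW : 0 < 1 + (k * s) ^ 2 := by positivity
  have hcs : c ^ 2 = 1 - s ^ 2 := by rw [hcdef, cos_sq']
  have hsq : α ^ 2 + 2 * α * c * s * k ^ 2 / (1 + (k * s) ^ 2) ≤ θ ^ 2 := by
    have : 2 * α * (c - p) = (2 * α * c * s * k ^ 2 / (1 + (k * s) ^ 2)) * s := by
      rw [hpe]; field_simp; ring
    rw [this] at key
    linarith [le_of_mul_le_mul_right key hs]
  have hf : s / π / (1 + (k * s) ^ 2) ≤ chordProfile a σ := by
    have hz := div_one_add_sq_le_arctan (z := k * s) (by positivity)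
    unfold chordProfile
    rw [← hk, ← hαdef, ← hsdef]
    calc s / π / (1 + (k * s) ^ 2) = a⁻¹ * (k * s / (1 + (k * s) ^ 2)) := by
          rw [hk]; field_simp
      _ ≤ _ := by gcongr
  have hF2 : chordProfileDerivTwo a σ
      = -(π * s * (1 + 2 * k ^ 2 - (k * s) ^ 2)) / (1 + (k * s) ^ 2) ^ 2 := rfl
  have hmain : 0 ≤ chordProfileDerivTwo a σ + π ^ 2 * (chordProfile a σ - σ * p)
      + p * θ ^ 2 / σ := by
    have e1 : p * (α ^ 2 + 2 * α * c * s * k ^ 2 / (1 + (k * s) ^ 2)) / σ ≤ p * θ ^ 2 / σ := by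
      gcongr
    have e2 : π ^ 2 * (s / π / (1 + (k * s) ^ 2)) ≤ π ^ 2 * chordProfile a σ := by gcongr
    have e3 : chordProfileDerivTwo a σ + π ^ 2 * (s / π / (1 + (k * s) ^ 2)) - π ^ 2 * σ * p
        + p * (α ^ 2 + 2 * α * c * s * k ^ 2 / (1 + (k * s) ^ 2)) / σ = 0 := by
      rw [hF2, hpe, hαdef]
      clear_value k s c
      field_simp
      linear_combination (2 * π * s * k ^ 2) * hcs
    linarith
  have e4 : p * θ ^ 2 / σ ≤ p * arccos (μ * p) ^ 2 / σ := by
    have : 0 ≤ θ := arccos_nonneg p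
    gcongr
  have : μ * chordProfileDerivTwo a σ + π ^ 2 * (μ * chordProfile a σ - σ * (μ * p))
      + μ * p * arccos (μ * p) ^ 2 / σ = μ * (chordProfileDerivTwo a σ
        + π ^ 2 * (chordProfile a σ - σ * p) + p * arccos (μ * p) ^ 2 / σ) := by ring
  rw [this]
  exact mul_nonneg hμ0 (by linarith)

/-! ### Analytic tools -/

/-- Wirtinger's inequality for periodic real functions of mean zero. -/
lemma wirtinger_real {f f' : ℝ → ℝ} {L : ℝ} (hL : 0 < L) (hf : ∀ x, HasDerivAt f (f' x) x)
    (hf' : Continuous f') (hper : f L = f 0) (hmean : ∫ x in (0 : ℝ)..L, f x = 0) :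
    (2 * π) ^ 2 * ∫ x in (0 : ℝ)..L, f x ^ 2 ≤ L ^ 2 * ∫ x in (0 : ℝ)..L, f' x ^ 2 := by
  have hfc : Continuous f := continuous_iff_continuousAt.2 fun x => (hf x).continuousAt
  have hmem : ∀ {k : ℝ → ℝ}, Continuous k →
      MemLp (fun x => (k x : ℂ)) 2 (volume.restrict (Set.Ioc 0 L)) := by
    intro k hk
    have hk' : Continuous fun x => (k x : ℂ) := Complex.continuous_ofReal.comp hk
    obtain ⟨C, hC⟩ := (isCompact_Icc (a := (0 : ℝ)) (b := L)).exists_bound_of_continuousOn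
      hk'.continuousOn
    refine MemLp.of_bound hk'.aestronglyMeasurable C ?_
    filter_upwards [ae_restrict_mem measurableSet_Ioc] with x hx
    exact hC x (Set.Ioc_subset_Icc_self hx)
  have s1 := hasSum_sq_fourierCoeffOn hL (hmem hfc)
  have s2 := hasSum_sq_fourierCoeffOn hL (hmem hf')
  have hle : ∀ n : ℤ, (2 * π) ^ 2 * ‖fourierCoeffOn hL (fun x => (f x : ℂ)) n‖ ^ 2
      ≤ L ^ 2 * ‖fourierCoeffOn hL (fun x => (f' x : ℂ)) n‖ ^ 2 := by
    intro n
    rcases eq_or_ne n 0 with rfl | hn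
    · have : fourierCoeffOn hL (fun x => (f x : ℂ)) 0 = 0 := by
        rw [fourierCoeffOn_eq_integral]
        simp only [neg_zero, fourier_zero, one_smul]
        rw [intervalIntegral.integral_ofReal, hmean]
        simp
      rw [this]; simp; positivity
    · have h := fourierCoeffOn_of_hasDerivAt hL hn (fun x _ => (hf x).ofReal_comp)
        ((Complex.continuous_ofReal.comp hf').intervalIntegrable _ _)
      rw [hper, sub_self, mul_zero, zero_sub] at h
      have hn' : (n : ℝ) ^ 2 ≥ 1 := by
        have : 1 ≤ n ^ 2 := Int.one_le_abs hn |>.trans (by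
          rw [← sq_abs]; nlinarith [Int.one_le_abs hn])
        exact_mod_cast this
      have h2 : (2 * π * n) ^ 2 * ‖fourierCoeffOn hL (fun x => (f x : ℂ)) n‖ ^ 2
          = L ^ 2 * ‖fourierCoeffOn hL (fun x => (f' x : ℂ)) n‖ ^ 2 := by
        have hne : (n : ℝ) ≠ 0 := by exact_mod_cast hn
        rw [h]
        simp only [norm_mul, norm_div, norm_neg, norm_one, Complex.norm_ofNat, Complex.norm_real,
          Complex.norm_I, Complex.norm_intCast, norm_eq_abs, Complex.ofReal_zero, sub_zero]
        rw [abs_of_pos pi_pos, abs_of_pos hL]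
        have hab : (n : ℝ) ^ 2 = |(n : ℝ)| ^ 2 := (sq_abs _).symm
        have hane : |(n : ℝ)| ≠ 0 := abs_ne_zero.2 hne
        rw [mul_pow _ (n : ℝ), hab]
        field_simp
      rw [← h2, mul_pow _ (n : ℝ)]
      have : 0 ≤ (2 * π) ^ 2 * ‖fourierCoeffOn hL (fun x => (f x : ℂ)) n‖ ^ 2 := by positivity
      nlinarith
  have := hasSum_le hle (s1.mul_left _) (s2.mul_left _)
  simp only [sub_zero, smul_eq_mul, Complex.norm_real, norm_eq_abs, sq_abs] at this
  have h2 : (2 * π) ^ 2 * (L⁻¹ * ∫ x in (0 : ℝ)..L, f x ^ 2)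
      = L⁻¹ * ((2 * π) ^ 2 * ∫ x in (0 : ℝ)..L, f x ^ 2) := by ring
  have h3 : L ^ 2 * (L⁻¹ * ∫ x in (0 : ℝ)..L, f' x ^ 2)
      = L⁻¹ * (L ^ 2 * ∫ x in (0 : ℝ)..L, f' x ^ 2) := by ring
  rw [h2, h3] at this
  exact le_of_mul_le_mul_left this (by positivity)

lemma wirtinger_unit {T N : ℝ → EuclideanSpace ℝ (Fin 3)} {L : ℝ} (hL : 0 < L)
    (hT : ∀ x, HasDerivAt T (N x) x) (hN : Continuous N) (hper : T L = T 0)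
    (hmean : ∫ x in (0 : ℝ)..L, T x = 0) (hunit : ∀ x, ‖T x‖ = 1) :
    4 * π ^ 2 ≤ L * ∫ x in (0 : ℝ)..L, ‖N x‖ ^ 2 := by
  have hTc : Continuous T := continuous_iff_continuousAt.2 fun x => (hT x).continuousAt
  have hi : ∀ i : Fin 3, (2 * π) ^ 2 * ∫ x in (0 : ℝ)..L, T x i ^ 2
      ≤ L ^ 2 * ∫ x in (0 : ℝ)..L, N x i ^ 2 := by
    intro i
    have hproj : ∀ x, HasDerivAt (fun x => T x i) (N x i) x := fun x =>
      (EuclideanSpace.proj (𝕜 := ℝ) i).hasFDerivAt.comp_hasDerivAt x (hT x)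
    refine wirtinger_real hL hproj ((EuclideanSpace.proj (𝕜 := ℝ) i).continuous.comp hN)
      (by rw [hper]) ?_
    have := (EuclideanSpace.proj (𝕜 := ℝ) i).intervalIntegral_comp_comm
      (hTc.intervalIntegrable (μ := volume) 0 L)
    rw [hmean] at this
    simpa using this
  have hsum : ∀ {V : ℝ → EuclideanSpace ℝ (Fin 3)}, Continuous V →
      ∫ x in (0 : ℝ)..L, ‖V x‖ ^ 2 = ∑ i : Fin 3, ∫ x in (0 : ℝ)..L, V x i ^ 2 := by
    intro V hV
    rw [← intervalIntegral.integral_finsetSum]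
    · simp only [EuclideanSpace.norm_sq_eq, norm_eq_abs, sq_abs]
    · intro i _
      exact (((EuclideanSpace.proj (𝕜 := ℝ) i).continuous.comp hV).pow 2).intervalIntegrable _ _
  have h1 := hsum hTc
  have h2 := hsum hN
  simp only [hunit, one_pow, intervalIntegral.integral_const, sub_zero, smul_eq_mul, mul_one] at h1
  have := Finset.sum_le_sum (fun i (_ : i ∈ Finset.univ) => hi i)
  rw [← Finset.mul_sum, ← Finset.mul_sum, ← h1, ← h2] at this
  have h3 : (2 * π) ^ 2 * L = L * (4 * π ^ 2) := by ring
  rw [h3, pow_two L, mul_assoc] at this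
  exact le_of_mul_le_mul_left this hL

/-- The necessary second order condition at a local minimum. -/
lemma IsLocalMin.second_deriv_nonneg {q q' : ℝ → ℝ} {q'' x : ℝ} (h : IsLocalMin q x)
    (hq : ∀ᶠ y in nhds x, HasDerivAt q (q' y) y) (hq' : HasDerivAt q' q'' x) :
    q' x = 0 ∧ 0 ≤ q'' := by
  have h1 : q' x = 0 := h.hasDerivAt_eq_zero hq.self_of_nhds
  have heq : deriv q =ᶠ[nhds x] q' := hq.mono fun y hy => hy.deriv
  have hdd : deriv (deriv q) x = q'' := by rw [heq.deriv_eq, hq'.deriv]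
  refine ⟨h1, ?_⟩
  by_contra! hneg
  have hmax : IsLocalMax q x := isLocalMax_of_deriv_deriv_neg (by rw [hdd]; exact hneg)
    (by rw [heq.self_of_nhds, h1]) hq.self_of_nhds.continuousAt
  have hconst : q =ᶠ[nhds x] fun _ => q x := by
    filter_upwards [h, hmax] with y h1 h2 using le_antisymm h2 h1
  have : deriv q =ᶠ[nhds x] fun _ => 0 := hconst.deriv.trans (by simp)
  rw [this.deriv_eq, deriv_const] at hdd
  exact hneg.ne hdd.symm

lemma sq_integral_le {k : ℝ → ℝ} (hk : Continuous k) {x y : ℝ} (hxy : x < y) :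
    (∫ s in x..y, k s) ^ 2 ≤ (y - x) * ∫ s in x..y, k s ^ 2 := by
  set I := ∫ s in x..y, k s with hI
  set m := I / (y - x) with hm
  have hpos : 0 < y - x := sub_pos.2 hxy
  have h0 : 0 ≤ ∫ s in x..y, (k s - m) ^ 2 :=
    intervalIntegral.integral_nonneg hxy.le fun s _ => sq_nonneg _
  have h1 : ∫ s in x..y, (k s - m) ^ 2 = (∫ s in x..y, k s ^ 2) - 2 * m * I + m ^ 2 * (y - x) := by
    have : ∀ s, (k s - m) ^ 2 = (k s ^ 2 - 2 * m * k s) + m ^ 2 := fun s => by ring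
    simp_rw [this]
    rw [intervalIntegral.integral_add, intervalIntegral.integral_sub,
      intervalIntegral.integral_const_mul, intervalIntegral.integral_const, smul_eq_mul, ← hI]
    · ring
    all_goals exact Continuous.intervalIntegrable (by fun_prop) _ _
  rw [h1] at h0
  have h2 : m * (y - x) = I := by rw [hm]; field_simp
  nlinarith

/-- A unit vector field turning through the angle `2 arccos p` has at least this total
variation. -/
lemma two_mul_arccos_le_integral {T N : ℝ → EuclideanSpace ℝ (Fin 3)} {x y p : ℝ} (hxy : x < y)
    (hT : ∀ s, HasDerivAt T (N s) s) (hN : Continuous N) (hunit : ∀ s, ‖T s‖ = 1)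
    (hp : 0 ≤ p) (hsum : ‖T x + T y‖ ^ 2 = 4 * p ^ 2) :
    2 * arccos p ≤ ∫ s in x..y, ‖N s‖ := by
  have hint0 : 0 ≤ ∫ s in x..y, ‖N s‖ :=
    intervalIntegral.integral_nonneg hxy.le fun s _ => norm_nonneg _
  rcases le_or_gt 1 p with h1 | h1
  · rw [arccos_eq_zero.2 h1]; simpa using hint0
  have hadd := norm_add_sq_real (T x) (T y)
  have hsub := norm_sub_sq_real (T x) (T y)
  rw [hunit, hunit] at hadd hsub
  set q := √(1 - p ^ 2) with hq
  have hq2 : q ^ 2 = 1 - p ^ 2 := sq_sqrt (by nlinarith)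
  have hq0 : 0 < q := sqrt_pos.2 (by nlinarith)
  have hq1 : q ≤ 1 := by nlinarith
  have hnsub : ‖T x - T y‖ = 2 * q := by
    have : ‖T x - T y‖ ^ 2 = (2 * q) ^ 2 := by nlinarith
    exact (sq_eq_sq₀ (norm_nonneg _) (by positivity)).1 this
  set e := (2 * q)⁻¹ • (T x - T y) with he
  have hne : ‖e‖ = 1 := by
    rw [he, norm_smul, hnsub, norm_eq_abs, abs_of_pos (by positivity)]
    field_simp
  have hinner : inner ℝ (T x) (T y) = 1 - 2 * q ^ 2 := by nlinarith
  have hex : inner ℝ (T x) e = q := by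
    rw [he, inner_smul_right, inner_sub_right, real_inner_self_eq_norm_sq, hunit, hinner]
    field_simp; ring
  have hey : inner ℝ (T y) e = -q := by
    rw [he, inner_smul_right, inner_sub_right, real_inner_self_eq_norm_sq, hunit,
      real_inner_comm, hinner]
    field_simp; ring
  clear_value e
  have hTN : ∀ s, inner ℝ (N s) (T s) = 0 := by
    intro s
    have h := (hT s).inner ℝ (hT s)
    have h2 : HasDerivAt (fun s => inner ℝ (T s) (T s)) 0 s := by
      simp only [real_inner_self_eq_norm_sq, hunit]
      exact hasDerivAt_const _ _
    have := h.unique h2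
    rw [real_inner_comm (N s) (T s)] at this
    linarith
  have hbound : ∀ s, inner ℝ (N s) e ^ 2 ≤ ‖N s‖ ^ 2 * (1 - inner ℝ (T s) e ^ 2) := by
    intro s
    have h1 : inner ℝ (N s) e = inner ℝ (N s) (e - inner ℝ (T s) e • T s) := by
      rw [inner_sub_right, inner_smul_right, hTN]; ring
    have h2 : ‖e - inner ℝ (T s) e • T s‖ ^ 2 = 1 - inner ℝ (T s) e ^ 2 := by
      rw [norm_sub_sq_real, norm_smul, hunit, hne, inner_smul_right, real_inner_comm,
        norm_eq_abs, mul_one, sq_abs]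
      ring
    rw [h1, ← h2, ← mul_pow]
    exact sq_le_sq' (neg_le_of_abs_le (abs_real_inner_le_norm _ _)) (real_inner_le_norm _ _)
  have habs : ∀ s, |inner ℝ (T s) e| ≤ 1 := fun s => by
    have := abs_real_inner_le_norm (T s) e
    rwa [hunit, hne, mul_one] at this
  have hTc : Continuous T := continuous_iff_continuousAt.2 fun x => (hT x).continuousAt
  have main : ∀ r ∈ Set.Ioo (0 : ℝ) 1, 2 * arcsin (r * q) ≤ ∫ s in x..y, ‖N s‖ := by
    intro r hr
    have hsq : ∀ s, (r * inner ℝ (T s) e) ^ 2 < 1 := fun s => by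
      have h1 : inner ℝ (T s) e ^ 2 ≤ 1 := by
        rw [sq_le_one_iff_abs_le_one]; exact habs s
      rw [mul_pow]
      nlinarith [hr.1, hr.2, sq_nonneg (inner ℝ (T s) e)]
    have hder : ∀ s, HasDerivAt (fun s => arcsin (r * inner ℝ (T s) e))
        (1 / √(1 - (r * inner ℝ (T s) e) ^ 2) * (r * inner ℝ (N s) e)) s := by
      intro s
      have h1 : HasDerivAt (fun s => r * inner ℝ (T s) e) (r * inner ℝ (N s) e) s := by
        have := ((hT s).inner ℝ (hasDerivAt_const s e)).const_mul r
        simpa using this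
      have hlt := abs_lt.1 ((sq_lt_one_iff_abs_lt_one _).1 (hsq s))
      exact (hasDerivAt_arcsin (by linarith [hlt.1]) (by linarith [hlt.2])).comp s h1
    have hcont : Continuous fun s => 1 / √(1 - (r * inner ℝ (T s) e) ^ 2) * (r * inner ℝ (N s) e) := by
      refine Continuous.mul (Continuous.div continuous_const (by fun_prop) fun s => ?_) (by fun_prop)
      exact (sqrt_pos.2 (by linarith [hsq s])).ne'
    have hftc := intervalIntegral.integral_eq_sub_of_hasDerivAt (fun s _ => hder s)
      (hcont.intervalIntegrable x y)
    rw [hex, hey, mul_neg, arcsin_neg] at hftc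
    have hle : ∀ s, -(1 / √(1 - (r * inner ℝ (T s) e) ^ 2) * (r * inner ℝ (N s) e)) ≤ ‖N s‖ := by
      intro s
      refine (neg_le_abs _).trans ?_
      have hs0 : 0 < √(1 - (r * inner ℝ (T s) e) ^ 2) := sqrt_pos.2 (by linarith [hsq s])
      rw [abs_mul, abs_of_pos (by positivity), div_mul_eq_mul_div, one_mul, div_le_iff₀ hs0]
      refine abs_le_of_sq_le_sq ?_ (by positivity)
      rw [mul_pow, mul_pow, sq_sqrt (by linarith [hsq s]), mul_pow]
      have hr2 : r ^ 2 ≤ 1 := by nlinarith [hr.1, hr.2]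
      nlinarith [hbound s, sq_nonneg ‖N s‖, sq_nonneg r, sq_nonneg (inner ℝ (N s) e)]
    have hmono := intervalIntegral.integral_mono_on hxy.le
      (hcont.neg.intervalIntegrable (μ := volume) x y)
      (hN.norm.intervalIntegrable (μ := volume) x y) (fun s _ => hle s)
    simp only [Pi.neg_apply] at hmono
    rw [intervalIntegral.integral_neg, hftc] at hmono
    linarith
  have hlim : Filter.Tendsto (fun r => 2 * arcsin (r * q)) (nhdsWithin 1 (Set.Iio 1))
      (nhds (2 * arcsin (1 * q))) := by
    have : Continuous fun r => 2 * arcsin (r * q) :=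
      continuous_const.mul (continuous_arcsin.comp (continuous_id.mul continuous_const))
    exact this.continuousAt.tendsto.mono_left nhdsWithin_le_nhds
  have hmem : ∀ᶠ r in nhdsWithin (1 : ℝ) (Set.Iio 1), r ∈ Set.Ioo (0 : ℝ) 1 :=
    Ioo_mem_nhdsLT one_pos
  have := le_of_tendsto hlim (hmem.mono main)
  rwa [one_mul, hq, ← arccos_eq_arcsin hp] at this

/-! ### Spherical curves parametrised by arclength -/

/-- A smooth unit speed curve on the unit sphere. -/
structure IsSphericalUnitSpeed (c : ℝ → EuclideanSpace ℝ (Fin 3)) : Prop where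
  contDiff : ContDiff ℝ (⊤ : ℕ∞) c
  norm_eq_one : ∀ s, ‖c s‖ = 1
  norm_deriv : ∀ s, ‖deriv c s‖ = 1

namespace IsSphericalUnitSpeed

variable {c : ℝ → EuclideanSpace ℝ (Fin 3)}

lemma contDiff_deriv (h : IsSphericalUnitSpeed c) : ContDiff ℝ (⊤ : ℕ∞) (deriv c) :=
  (contDiff_infty_iff_deriv.1 h.contDiff).2

lemma contDiff_deriv_deriv (h : IsSphericalUnitSpeed c) :
    ContDiff ℝ (⊤ : ℕ∞) (deriv (deriv c)) :=
  (contDiff_infty_iff_deriv.1 h.contDiff_deriv).2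

lemma contDiff_deriv_deriv_deriv (h : IsSphericalUnitSpeed c) :
    ContDiff ℝ (⊤ : ℕ∞) (deriv (deriv (deriv c))) :=
  (contDiff_infty_iff_deriv.1 h.contDiff_deriv_deriv).2

lemma hasDerivAt (h : IsSphericalUnitSpeed c) (s : ℝ) : HasDerivAt c (deriv c s) s :=
  (h.contDiff.differentiable (by simp) s).hasDerivAt

lemma hasDerivAt_deriv (h : IsSphericalUnitSpeed c) (s : ℝ) :
    HasDerivAt (deriv c) (deriv (deriv c) s) s :=
  (h.contDiff_deriv.differentiable (by simp) s).hasDerivAt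

lemma hasDerivAt_deriv_deriv (h : IsSphericalUnitSpeed c) (s : ℝ) :
    HasDerivAt (deriv (deriv c)) (deriv (deriv (deriv c)) s) s :=
  (h.contDiff_deriv_deriv.differentiable (by simp) s).hasDerivAt

lemma inner_deriv (h : IsSphericalUnitSpeed c) (s : ℝ) : inner ℝ (c s) (deriv c s) = 0 := by
  have h1 := (h.hasDerivAt s).inner ℝ (h.hasDerivAt s)
  have h2 : HasDerivAt (fun s => inner ℝ (c s) (c s)) 0 s := by
    simp only [real_inner_self_eq_norm_sq, h.norm_eq_one]
    exact hasDerivAt_const _ _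
  have := h1.unique h2
  rw [real_inner_comm (c s) (deriv c s)] at this
  linarith

lemma inner_deriv_deriv (h : IsSphericalUnitSpeed c) (s : ℝ) :
    inner ℝ (c s) (deriv (deriv c) s) = -1 := by
  have h1 := (h.hasDerivAt s).inner ℝ (h.hasDerivAt_deriv s)
  have h2 : HasDerivAt (fun s => inner ℝ (c s) (deriv c s)) 0 s := by
    simp only [h.inner_deriv]
    exact hasDerivAt_const _ _
  have := h1.unique h2
  rw [real_inner_self_eq_norm_sq, h.norm_deriv] at this
  linarith

lemma inner_deriv_second (h : IsSphericalUnitSpeed c) (s : ℝ) :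
    inner ℝ (deriv c s) (deriv (deriv c) s) = 0 := by
  have h1 := (h.hasDerivAt_deriv s).inner ℝ (h.hasDerivAt_deriv s)
  have h2 : HasDerivAt (fun s => inner ℝ (deriv c s) (deriv c s)) 0 s := by
    simp only [real_inner_self_eq_norm_sq, h.norm_deriv]
    exact hasDerivAt_const _ _
  have := h1.unique h2
  rw [real_inner_comm (deriv c s) (deriv (deriv c) s)] at this
  linarith

lemma inner_deriv_third (h : IsSphericalUnitSpeed c) (s : ℝ) :
    inner ℝ (deriv c s) (deriv (deriv (deriv c)) s) = -‖deriv (deriv c) s‖ ^ 2 := by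
  have h1 := (h.hasDerivAt_deriv s).inner ℝ (h.hasDerivAt_deriv_deriv s)
  have h2 : HasDerivAt (fun s => inner ℝ (deriv c s) (deriv (deriv c) s)) 0 s := by
    simp only [h.inner_deriv_second]
    exact hasDerivAt_const _ _
  have := h1.unique h2
  rw [real_inner_self_eq_norm_sq] at this
  linarith

lemma one_le_norm_deriv_deriv (h : IsSphericalUnitSpeed c) (s : ℝ) :
    1 ≤ ‖deriv (deriv c) s‖ := by
  have := abs_real_inner_le_norm (c s) (deriv (deriv c) s)
  rwa [h.inner_deriv_deriv, h.norm_eq_one, one_mul, abs_neg, abs_one] at this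

/-- Short chords of a curve with curvature `> √A` are bounded by those of a circle. -/
lemma exists_chord_sq_le (h : IsSphericalUnitSpeed c) {s A : ℝ}
    (hA : A < ‖deriv (deriv c) s‖ ^ 2) :
    ∃ δ > 0, ∀ x ∈ Set.Icc 0 δ, ‖c (s + x) - c s‖ ^ 2 ≤ x ^ 2 - A * x ^ 4 / 12 := by
  have hsh : ∀ {f : ℝ → EuclideanSpace ℝ (Fin 3)} {f' : EuclideanSpace ℝ (Fin 3)} {x : ℝ},
      HasDerivAt f f' (s + x) → HasDerivAt (fun x => f (s + x)) f' x := fun hf =>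
    hf.comp_const_add s _
  have hD : ∀ x, HasDerivAt (fun x => c (s + x) - c s) (deriv c (s + x)) x := fun x =>
    (hsh (h.hasDerivAt (s + x))).sub_const _
  have h3 : HasDerivAt (fun x => inner ℝ (c (s + x) - c s) (deriv (deriv (deriv c)) (s + x)))
      (-‖deriv (deriv c) s‖ ^ 2) 0 := by
    have h4 : HasDerivAt (deriv (deriv (deriv c))) (deriv (deriv (deriv (deriv c))) (s + 0)) (s + 0) :=
      (h.contDiff_deriv_deriv_deriv.differentiable (by simp) _).hasDerivAt
    have := (hD 0).inner ℝ (hsh h4)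
    simpa [h.inner_deriv_third] using this
  have hsmall : ∀ᶠ x in nhds (0 : ℝ), 0 ≤ x →
      inner ℝ (c (s + x) - c s) (deriv (deriv (deriv c)) (s + x)) ≤ -A * x := by
    have := h3.isLittleO.def (sub_pos.2 hA)
    filter_upwards [this] with x hx hx0
    simp only [sub_zero, add_zero, sub_self, inner_zero_left, smul_eq_mul, norm_eq_abs,
      abs_of_nonneg hx0] at hx
    have := (abs_le.1 hx).2
    nlinarith
  obtain ⟨ε, hε, hball⟩ := Metric.eventually_nhds_iff.1 hsmall
  refine ⟨ε / 2, by positivity, fun x hx => ?_⟩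
  have e3 : ∀ y ∈ Set.Icc 0 x,
      inner ℝ (c (s + y) - c s) (deriv (deriv (deriv c)) (s + y)) ≤ -A * y := fun y hy =>
    hball (by rw [dist_zero_right, norm_eq_abs, abs_of_nonneg hy.1]; linarith [hy.2, hx.2]) hy.1
  have e2 : ∀ y ∈ Set.Icc 0 x,
      inner ℝ (c (s + y) - c s) (deriv (deriv c) (s + y)) ≤ -A * y ^ 2 / 2 := by
    intro y hy
    have := apply_zero_le_of_hasDerivAt_nonneg hy.1
      (f := fun y => -A * y ^ 2 / 2 - inner ℝ (c (s + y) - c s) (deriv (deriv c) (s + y)))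
      (f' := fun y => -A * y - inner ℝ (c (s + y) - c s) (deriv (deriv (deriv c)) (s + y)))
      (fun z _ => by
        have h1 := (hD z).inner ℝ (hsh (h.hasDerivAt_deriv_deriv (s + z)))
        rw [h.inner_deriv_second, add_zero] at h1
        have h2 : HasDerivAt (fun y : ℝ => -A * y ^ 2 / 2) (-A * z) z :=
          (((hasDerivAt_pow 2 z).const_mul (-A)).div_const 2).congr_deriv (by norm_num; ring)
        exact h2.sub h1)
      (fun z hz => by linarith [e3 z ⟨hz.1, hz.2.trans hy.2⟩])
    simp only [add_zero, sub_self, inner_zero_left] at this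
    linarith
  have e1 : ∀ y ∈ Set.Icc 0 x,
      inner ℝ (c (s + y) - c s) (deriv c (s + y)) ≤ y - A * y ^ 3 / 6 := by
    intro y hy
    have := apply_zero_le_of_hasDerivAt_nonneg hy.1
      (f := fun y => y - A * y ^ 3 / 6 - inner ℝ (c (s + y) - c s) (deriv c (s + y)))
      (f' := fun y => 1 - A * y ^ 2 / 2 - (inner ℝ (c (s + y) - c s) (deriv (deriv c) (s + y)) + 1))
      (fun z _ => by
        have h1 := (hD z).inner ℝ (hsh (h.hasDerivAt_deriv (s + z)))
        rw [real_inner_self_eq_norm_sq, h.norm_deriv, one_pow] at h1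
        have h2 : HasDerivAt (fun y : ℝ => A * y ^ 3 / 6) (A * z ^ 2 / 2) z :=
          (((hasDerivAt_pow 3 z).const_mul A).div_const 6).congr_deriv (by norm_num; ring)
        exact ((hasDerivAt_id z).sub h2).sub h1)
      (fun z hz => by linarith [e2 z ⟨hz.1, hz.2.trans hy.2⟩])
    simp only [add_zero, sub_self, inner_zero_left] at this
    linarith
  have := apply_zero_le_of_hasDerivAt_nonneg hx.1
    (f := fun y => y ^ 2 - A * y ^ 4 / 12 - inner ℝ (c (s + y) - c s) (c (s + y) - c s))
    (f' := fun y => 2 * y - A * y ^ 3 / 3 - 2 * inner ℝ (c (s + y) - c s) (deriv c (s + y)))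
    (fun z _ => by
      have h1 := (hD z).inner ℝ (hD z)
      rw [real_inner_comm (c (s + z) - c s) (deriv c (s + z)), ← two_mul] at h1
      have h2 : HasDerivAt (fun y : ℝ => A * y ^ 4 / 12) (A * z ^ 3 / 3) z :=
        (((hasDerivAt_pow 4 z).const_mul A).div_const 12).congr_deriv (by norm_num; ring)
      exact (((hasDerivAt_pow 2 z).congr_deriv (by norm_num)).sub h2).sub h1)
    (fun z hz => by linarith [e1 z hz])
  simp only [add_zero, sub_self, inner_zero_left, real_inner_self_eq_norm_sq] at this
  linarith

/-- A cubic lower bound on short chords bounds the curvature. -/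
lemma norm_deriv_deriv_sq_le (h : IsSphericalUnitSpeed c) {s B δ : ℝ} (hB : 0 ≤ B) (hδ : 0 < δ)
    (hchord : ∀ x ∈ Set.Ioo 0 δ, x - B * x ^ 3 ≤ ‖c (s + x) - c s‖) :
    ‖deriv (deriv c) s‖ ^ 2 ≤ 24 * B := by
  by_contra! hlt
  obtain ⟨A, hA1, hA2⟩ := exists_between hlt
  obtain ⟨ε, hε, hle⟩ := h.exists_chord_sq_le hA2
  obtain ⟨x, hx0, hx1⟩ := exists_between (show (0 : ℝ) < min (min ε δ) (1 / (1 + B)) by positivity)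
  have hxε : x ≤ ε := hx1.le.trans ((min_le_left _ _).trans (min_le_left _ _))
  have hxδ : x < δ := hx1.trans_le ((min_le_left _ _).trans (min_le_right _ _))
  have hxB : x * (1 + B) < 1 := by
    have := hx1.trans_le (min_le_right _ _)
    rwa [lt_div_iff₀ (by positivity)] at this
  have h1 := hle x ⟨hx0.le, hxε⟩
  have h2 := hchord x ⟨hx0, hxδ⟩
  have hx2 : x ≤ 1 := by nlinarith
  have h3 : 0 ≤ x - B * x ^ 3 := by
    have : B * x ^ 2 ≤ 1 := by
      have : x ^ 2 ≤ x := by nlinarith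
      nlinarith
    have : x - B * x ^ 3 = x * (1 - B * x ^ 2) := by ring
    rw [this]; exact mul_nonneg hx0.le (by linarith)
  have h4 : (x - B * x ^ 3) ^ 2 ≤ ‖c (s + x) - c s‖ ^ 2 := by gcongr
  have h5 : 0 < x ^ 4 := by positivity
  have h6 : 0 ≤ B ^ 2 * x ^ 6 := by positivity
  nlinarith

/-- The Gram determinant dichotomy for two unit tangent vectors making equal angles with the
chord joining their base points. -/
lemma gram_dichotomy {x y v w : EuclideanSpace ℝ (Fin 3)} (hx : ‖x‖ = 1) (hy : ‖y‖ = 1)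
    (hv : ‖v‖ = 1) (hw : ‖w‖ = 1) (hxv : inner ℝ x v = 0) (hyw : inner ℝ y w = 0)
    (hq : inner ℝ x w = -inner ℝ y v) :
    (1 + inner ℝ x y) * (1 - inner ℝ v w) = inner ℝ y v ^ 2 ∨
      (1 - inner ℝ x y) * (1 + inner ℝ v w) = inner ℝ y v ^ 2 := by
  have hdep : ¬ LinearIndependent ℝ ![x, y, v, w] := by
    intro hli
    have := hli.fintype_card_le_finrank
    simp at this
  obtain ⟨g, hg, i, hi⟩ := Fintype.not_linearIndependent_iff.1 hdep
  simp only [Fin.sum_univ_four, Matrix.cons_val] at hg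
  set q := inner ℝ y v with hqd
  set r := inner ℝ x y with hrd
  set P := inner ℝ v w with hPd
  have key : ∀ z : EuclideanSpace ℝ (Fin 3),
      g 0 * inner ℝ z x + g 1 * inner ℝ z y + g 2 * inner ℝ z v + g 3 * inner ℝ z w = 0 := by
    intro z
    have := congrArg (fun k => inner ℝ z k) hg
    simpa [inner_add_right, inner_smul_right] using this
  have k1 := key x
  have k2 := key y
  have k3 := key v
  have k4 := key w
  rw [real_inner_self_eq_norm_sq, hx, ← hrd, hxv, hq] at k1
  rw [real_inner_self_eq_norm_sq, hy, real_inner_comm, ← hrd, ← hqd, hyw] at k2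
  rw [real_inner_self_eq_norm_sq, hv, real_inner_comm, hxv, real_inner_comm, ← hqd, ← hPd] at k3
  rw [real_inner_self_eq_norm_sq, hw, real_inner_comm, hq, real_inner_comm, hyw, real_inner_comm,
    ← hPd] at k4
  by_contra! hcon
  obtain ⟨c1, c2⟩ := hcon
  have a1 : ((1 + r) * (1 - P) - q ^ 2) * (g 0 + g 1) = 0 := by
    linear_combination (1 - P) * (k1 + k2) - q * (k3 - k4)
  have a2 : ((1 + r) * (1 - P) - q ^ 2) * (g 2 - g 3) = 0 := by
    linear_combination (1 + r) * (k3 - k4) - q * (k1 + k2)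
  have b1 : ((1 - r) * (1 + P) - q ^ 2) * (g 0 - g 1) = 0 := by
    linear_combination (1 + P) * (k1 - k2) + q * (k3 + k4)
  have b2 : ((1 - r) * (1 + P) - q ^ 2) * (g 2 + g 3) = 0 := by
    linear_combination (1 - r) * (k3 + k4) + q * (k1 - k2)
  have a1' := (mul_eq_zero.1 a1).resolve_left (sub_ne_zero.2 c1)
  have a2' := (mul_eq_zero.1 a2).resolve_left (sub_ne_zero.2 c1)
  have b1' := (mul_eq_zero.1 b1).resolve_left (sub_ne_zero.2 c2)
  have b2' := (mul_eq_zero.1 b2).resolve_left (sub_ne_zero.2 c2)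
  apply hi
  fin_cases i <;> simp <;> linarith

/-- First and second order conditions at a pair of points where the chord length touches a
function `H` of arclength from above. -/
lemma chord_touching (h : IsSphericalUnitSpeed c) {H H' : ℝ → ℝ} {H'' x y : ℝ}
    (hH : ∀ z, HasDerivAt H (H' z) z) (hH' : HasDerivAt H' H'' (y - x))
    (hpos : 0 < H (y - x)) (heq : ‖c y - c x‖ = H (y - x))
    (hle : ∀ᶠ p in nhds (x, y), H (p.2 - p.1) ≤ ‖c p.2 - c p.1‖) :
    -‖c y - c x‖ ^ 2 ≤ inner ℝ (c y - c x) (deriv (deriv c) y - deriv (deriv c) x) ∨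
      (4 * H (y - x) * H'' ≤ inner ℝ (c y - c x) (deriv (deriv c) y - deriv (deriv c) x) ∧
        ‖deriv c x + deriv c y‖ ^ 2 = 4 * H' (y - x) ^ 2) := by
  have hHpos : ∀ᶠ p in nhds (x, y), 0 < H (p.2 - p.1) := by
    have : ContinuousAt (fun p : ℝ × ℝ => H (p.2 - p.1)) (x, y) :=
      ContinuousAt.comp (f := fun p : ℝ × ℝ => p.2 - p.1) (hH (y - x)).continuousAt (by fun_prop)
    exact this.eventually (lt_mem_nhds hpos)
  have htest : ∀ ζ : ℝ, ζ ^ 2 = 1 →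
      inner ℝ (c y - c x) (deriv c y - ζ • deriv c x) = H (y - x) * (H' (y - x) * (1 - ζ)) ∧
      0 ≤ inner ℝ (c y - c x) (deriv (deriv c) y - deriv (deriv c) x)
        + ‖deriv c y - ζ • deriv c x‖ ^ 2 - H' (y - x) ^ 2 * (1 - ζ) ^ 2
        - H (y - x) * H'' * (1 - ζ) ^ 2 := by
    intro ζ hζ
    have hlin : ∀ {f : ℝ → EuclideanSpace ℝ (Fin 3)} {f' : EuclideanSpace ℝ (Fin 3)} {z m ξ : ℝ},
        HasDerivAt f f' (z + m * ξ) → HasDerivAt (fun ξ => f (z + m * ξ)) (m • f') ξ := by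
      intro f f' z m ξ hf
      have hl : HasDerivAt (fun ξ => z + m * ξ) m ξ := by
        simpa using ((hasDerivAt_id ξ).const_mul m).const_add z
      exact hf.scomp ξ hl
    have hD : ∀ ξ, HasDerivAt (fun ξ => c (y + 1 * ξ) - c (x + ζ * ξ))
        ((1 : ℝ) • deriv c (y + 1 * ξ) - ζ • deriv c (x + ζ * ξ)) ξ := fun ξ =>
      (hlin (h.hasDerivAt _)).sub (hlin (h.hasDerivAt _))
    have hD2 : ∀ ξ, HasDerivAt (fun ξ => (1 : ℝ) • deriv c (y + 1 * ξ) - ζ • deriv c (x + ζ * ξ))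
        ((1 : ℝ) • (1 : ℝ) • deriv (deriv c) (y + 1 * ξ) - ζ • ζ • deriv (deriv c) (x + ζ * ξ)) ξ :=
      fun ξ => ((hlin (h.hasDerivAt_deriv _)).const_smul (1 : ℝ)).sub
        ((hlin (h.hasDerivAt_deriv _)).const_smul ζ)
    have hl : ∀ ξ : ℝ, HasDerivAt (fun ξ => (y + 1 * ξ) - (x + ζ * ξ)) (1 - ζ) ξ := by
      intro ξ
      have h1 : HasDerivAt (fun ξ : ℝ => y + 1 * ξ) 1 ξ := by
        simpa using (hasDerivAt_id ξ).const_add y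
      have h2 : HasDerivAt (fun ξ => x + ζ * ξ) ζ ξ := by
        simpa using ((hasDerivAt_id ξ).const_mul ζ).const_add x
      exact h1.sub h2
    have hHl : ∀ ξ, HasDerivAt (fun ξ => H ((y + 1 * ξ) - (x + ζ * ξ)))
        (H' ((y + 1 * ξ) - (x + ζ * ξ)) * (1 - ζ)) ξ := fun ξ => (hH _).comp ξ (hl ξ)
    have hHl2 : HasDerivAt (fun ξ => H' ((y + 1 * ξ) - (x + ζ * ξ)) * (1 - ζ))
        (H'' * (1 - ζ) * (1 - ζ)) 0 := by
      have : HasDerivAt H' H'' ((y + 1 * 0) - (x + ζ * 0)) := by simpa using hH'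
      exact (this.comp 0 (hl 0)).mul_const _
    have hq := fun ξ => ((hD ξ).inner ℝ (hD ξ)).sub ((hHl ξ).mul (hHl ξ))
    have hq2 := (((hD 0).inner ℝ (hD2 0)).add ((hD2 0).inner ℝ (hD 0))).sub
      ((hHl2.mul (hHl 0)).add ((hHl 0).mul hHl2))
    have hpath : Filter.Tendsto (fun ξ : ℝ => (x + ζ * ξ, y + 1 * ξ)) (nhds 0) (nhds (x, y)) := by
      have : Continuous fun ξ : ℝ => (x + ζ * ξ, y + 1 * ξ) := by fun_prop
      simpa using this.tendsto 0
    have hmin : IsLocalMin ((fun ξ => inner ℝ (c (y + 1 * ξ) - c (x + ζ * ξ))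
        (c (y + 1 * ξ) - c (x + ζ * ξ))) - ((fun ξ => H ((y + 1 * ξ) - (x + ζ * ξ)))
        * (fun ξ => H ((y + 1 * ξ) - (x + ζ * ξ))))) 0 := by
      filter_upwards [hpath.eventually hle, hpath.eventually hHpos] with ξ h1 h2
      simp only [Pi.sub_apply, Pi.mul_apply, mul_zero, add_zero, real_inner_self_eq_norm_sq] at *
      rw [heq]
      nlinarith
    obtain ⟨t1, t2⟩ := hmin.second_deriv_nonneg (Filter.Eventually.of_forall hq) hq2
    simp only [mul_zero, add_zero, one_smul, smul_smul, ← pow_two, hζ,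
      real_inner_self_eq_norm_sq] at t1 t2
    rw [real_inner_comm (c y - c x) (deriv c y - ζ • deriv c x)] at t1
    rw [real_inner_comm (c y - c x) (deriv (deriv c) y - deriv (deriv c) x)] at t2
    exact ⟨by linarith, by nlinarith⟩
  obtain ⟨a1, a2⟩ := htest 1 (by norm_num)
  obtain ⟨b1, b2⟩ := htest (-1) (by norm_num)
  rw [one_smul, sub_self, mul_zero, mul_zero] at a1
  rw [neg_one_smul, sub_neg_eq_add] at b1 b2
  rw [one_smul] at a2
  set d := H (y - x) with hd
  set p := H' (y - x) with hp
  set Q := inner ℝ (c y - c x) (deriv (deriv c) y - deriv (deriv c) x) with hQ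
  have n1 : ‖deriv c y - deriv c x‖ ^ 2 = 2 - 2 * inner ℝ (deriv c x) (deriv c y) := by
    rw [norm_sub_sq_real, h.norm_deriv, h.norm_deriv, real_inner_comm]; ring
  have n2 : ‖deriv c y + deriv c x‖ ^ 2 = 2 + 2 * inner ℝ (deriv c x) (deriv c y) := by
    rw [norm_add_sq_real, h.norm_deriv, h.norm_deriv, real_inner_comm]; ring
  have nd : d ^ 2 = 2 - 2 * inner ℝ (c x) (c y) := by
    rw [← heq, norm_sub_sq_real, h.norm_eq_one, h.norm_eq_one, real_inner_comm]; ring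
  simp only [inner_sub_left, inner_sub_right, inner_add_right, h.inner_deriv] at a1 b1
  have hq : inner ℝ (c x) (deriv c y) = -inner ℝ (c y) (deriv c x) := by linarith
  have hdp : inner ℝ (c y) (deriv c x) = d * p := by linarith
  have hsw : ‖deriv c x + deriv c y‖ ^ 2 = ‖deriv c y + deriv c x‖ ^ 2 := by rw [add_comm]
  rw [hsw, heq]
  rcases gram_dichotomy (h.norm_eq_one x) (h.norm_eq_one y) (h.norm_deriv x) (h.norm_deriv y)
    (h.inner_deriv x) (h.inner_deriv y) hq with hg | hg
  · left
    set r := inner ℝ (c x) (c y) with hr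
    have hcs : inner ℝ (c y) (deriv c x) ^ 2 ≤ 1 - r ^ 2 := by
      have h1 := abs_real_inner_le_norm (c y - r • c x) (deriv c x)
      rw [inner_sub_left, inner_smul_left, h.inner_deriv, mul_zero, sub_zero, h.norm_deriv,
        mul_one] at h1
      have h2 : ‖c y - r • c x‖ ^ 2 = 1 - r ^ 2 := by
        rw [norm_sub_sq_real, norm_smul, mul_pow, inner_smul_right, h.norm_eq_one, h.norm_eq_one,
          real_inner_comm, ← hr, norm_eq_abs, sq_abs]
        ring
      rw [← h2, ← sq_abs]
      gcongr
    have hr1 : -1 ≤ r := by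
      have := abs_real_inner_le_norm (c x) (c y)
      rw [h.norm_eq_one, h.norm_eq_one, mul_one] at this
      exact (abs_le.1 this).1
    rcases hr1.eq_or_lt with hr1 | hr1
    · have hanti : c y = -c x := by
        have : ‖c y + c x‖ ^ 2 = 0 := by
          rw [norm_add_sq_real, h.norm_eq_one, h.norm_eq_one, real_inner_comm, ← hr, ← hr1]
          norm_num
        exact eq_neg_of_add_eq_zero_left (norm_eq_zero.1 (pow_eq_zero_iff two_ne_zero |>.1 this))
      have e1 : inner ℝ (c y - c x) (deriv (deriv c) y - deriv (deriv c) x) = (-4 : ℝ) := by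
        have e2 := h.inner_deriv_deriv y
        have e3 := h.inner_deriv_deriv x
        have e4 : inner ℝ (c x) (deriv (deriv c) y) = (1 : ℝ) := by
          rw [hanti, inner_neg_left] at e2; linarith
        have e5 : inner ℝ (c y) (deriv (deriv c) x) = (1 : ℝ) := by
          rw [hanti, inner_neg_left]; linarith
        rw [inner_sub_left, inner_sub_right, inner_sub_right, e2, e3, e4, e5]
        norm_num
      rw [hQ, e1]; nlinarith
    · have : 1 - inner ℝ (deriv c x) (deriv c y) ≤ 1 - r := by
        have : (1 + r) * (1 - inner ℝ (deriv c x) (deriv c y)) ≤ (1 + r) * (1 - r) := by nlinarith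
        exact le_of_mul_le_mul_left this (by linarith)
      nlinarith
  · right
    have hP : 1 + inner ℝ (deriv c x) (deriv c y) = 2 * p ^ 2 := by
      have : d ^ 2 * (1 + inner ℝ (deriv c x) (deriv c y)) = d ^ 2 * (2 * p ^ 2) := by
        rw [hdp] at hg
        nlinarith
      exact mul_left_cancel₀ (by positivity) this
    constructor
    · nlinarith
    · linarith

end IsSphericalUnitSpeed

/-! ### The flow at a fixed time -/

namespace SphereCSF

/-- The arclength coordinate `u ↦ ∫₀ᵘ |∂_u γ|`. -/
def arcCoord (F : SphereCSF D) (t u : ℝ) : ℝ := ∫ w in (0 : ℝ)..u, F.speed w t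

section Slice

variable (F : SphereCSF D) {t : ℝ}

lemma contDiff_slice (ht : t ∈ D) : ContDiff ℝ (⊤ : ℕ∞) (fun u => F.γ u t) := by
  rw [← contDiffOn_univ]
  exact F.smooth.comp (f := fun u : ℝ => (u, t)) (by fun_prop) (fun u _ => ⟨trivial, ht⟩)

lemma speed_pos (ht : t ∈ D) (u : ℝ) : 0 < F.speed u t := norm_pos_iff.2 (F.regular t ht u)

lemma contDiff_speed (ht : t ∈ D) : ContDiff ℝ (⊤ : ℕ∞) (fun u => F.speed u t) :=
  ((contDiff_infty_iff_deriv.1 (F.contDiff_slice ht)).2).norm ℝ (F.regular t ht)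

lemma continuous_speed_slice (ht : t ∈ D) : Continuous (fun u => F.speed u t) :=
  (F.contDiff_speed ht).continuous

lemma hasDerivAt_arcCoord (ht : t ∈ D) (u : ℝ) : HasDerivAt (F.arcCoord t) (F.speed u t) u :=
  intervalIntegral.integral_hasDerivAt_right
    ((F.continuous_speed_slice ht).intervalIntegrable _ _)
    ((F.continuous_speed_slice ht).stronglyMeasurableAtFilter _ _)
    (F.continuous_speed_slice ht).continuousAt

lemma integral_speed (ht : t ∈ D) (u v : ℝ) :
    ∫ w in u..v, F.speed w t = F.arcCoord t v - F.arcCoord t u :=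
  (intervalIntegral.integral_interval_sub_left
    ((F.continuous_speed_slice ht).intervalIntegrable _ _)
    ((F.continuous_speed_slice ht).intervalIntegrable _ _)).symm

lemma speed_periodic (ht : t ∈ D) : Function.Periodic (fun u => F.speed u t) (2 * π) := by
  intro u
  simp only [speed]
  rw [← deriv_comp_add_const (fun v => F.γ v t) (2 * π) u]
  congr 2
  ext1 v
  exact F.periodic t ht v

lemma arcCoord_add_period (ht : t ∈ D) (u : ℝ) :
    F.arcCoord t (u + 2 * π) = F.arcCoord t u + F.length t := by
  have := (F.speed_periodic ht).intervalIntegral_add_eq u 0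
  rw [F.integral_speed ht, zero_add] at this
  simp only [length]
  linarith

lemma length_pos (ht : t ∈ D) : 0 < F.length t :=
  intervalIntegral.intervalIntegral_pos_of_pos
    ((F.continuous_speed_slice ht).intervalIntegrable _ _) (F.speed_pos ht) (by positivity)

lemma arcCoord_strictMono (ht : t ∈ D) : StrictMono (F.arcCoord t) :=
  strictMono_of_hasDerivAt_pos (F.hasDerivAt_arcCoord ht) (F.speed_pos ht)

lemma arcCoord_surjective (ht : t ∈ D) : Function.Surjective (F.arcCoord t) := by
  have hcont : Continuous (F.arcCoord t) :=
    continuous_iff_continuousAt.2 fun u => (F.hasDerivAt_arcCoord ht u).continuousAt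
  have h0 : F.arcCoord t 0 = 0 := intervalIntegral.integral_same
  have hL := F.length_pos ht
  have hn : ∀ n : ℕ, F.arcCoord t (n * (2 * π)) = n * F.length t := by
    intro n
    induction n with
    | zero => simp [h0]
    | succ n ih =>
      rw [Nat.cast_succ, add_mul, one_mul, F.arcCoord_add_period ht, ih]; ring
  have hm : ∀ n : ℕ, F.arcCoord t (-(n * (2 * π))) = -(n * F.length t) := by
    intro n
    induction n with
    | zero => simp [h0]
    | succ n ih =>
      have := F.arcCoord_add_period ht (-((n + 1 : ℕ) * (2 * π)))
      rw [show -((n + 1 : ℕ) * (2 * π)) + 2 * π = -(n * (2 * π)) by push_cast; ring, ih] at this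
      push_cast at this ⊢
      linarith
  intro s
  obtain ⟨n, hns⟩ := exists_nat_ge (|s| / F.length t)
  rw [div_le_iff₀ hL] at hns
  have h1 := abs_le.1 hns
  have := intermediate_value_Icc (a := -(n * (2 * π))) (b := n * (2 * π))
    (by have : 0 ≤ n * (2 * π) := by positivity
        linarith) hcont.continuousOn
  rw [hn, hm] at this
  obtain ⟨u, -, hu⟩ := this h1
  exact ⟨u, hu⟩

/-- Arclength reparametrisation of a time slice. -/
lemma exists_arclength_param (ht : t ∈ D) : ∃ c, IsSphericalUnitSpeed c ∧
    ∀ u, F.γ u t = c (F.arcCoord t u) := by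
  let e : ℝ ≃ₜ ℝ :=
    ((F.arcCoord_strictMono ht).orderIsoOfSurjective _ (F.arcCoord_surjective ht)).toHomeomorph
  have he : ∀ u, e u = F.arcCoord t u := fun u => rfl
  have hed : ∀ u, HasDerivAt e (F.speed u t) u := F.hasDerivAt_arcCoord ht
  have hes : ContDiff ℝ (⊤ : ℕ∞) e := by
    rw [contDiff_infty_iff_deriv]
    refine ⟨fun u => (hed u).differentiableAt, ?_⟩
    rw [show deriv e = fun u => F.speed u t from funext fun u => (hed u).deriv]
    exact F.contDiff_speed ht
  have hsymm : ContDiff ℝ (⊤ : ℕ∞) e.symm :=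
    e.contDiff_symm_deriv (f' := fun u => F.speed u t) (fun u => (F.speed_pos ht u).ne') hed hes
  refine ⟨fun s => F.γ (e.symm s) t, ⟨(F.contDiff_slice ht).comp hsymm,
    fun s => F.spherical t ht _, fun s => ?_⟩, fun u => ?_⟩
  · have h1 : HasDerivAt e.symm (F.speed (e.symm s) t)⁻¹ s :=
      HasDerivAt.of_local_left_inverse e.symm.continuous.continuousAt (hed _)
        (F.speed_pos ht _).ne' (Filter.Eventually.of_forall e.apply_symm_apply)
    have h2 := (((F.contDiff_slice ht).differentiable (by simp)
      (e.symm s)).hasDerivAt).scomp s h1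
    have h3 := h2.deriv
    simp only [Function.comp_def] at h3
    rw [h3, norm_smul, norm_inv, norm_eq_abs, abs_of_pos (F.speed_pos ht _)]
    exact inv_mul_cancel₀ (F.speed_pos ht _).ne'
  · simp only [← he, e.symm_apply_apply]

lemma pS_comp (ht : t ∈ D) {f : ℝ → ℝ → EuclideanSpace ℝ (Fin 3)} {b : ℝ → EuclideanSpace ℝ (Fin 3)}
    (hb : Differentiable ℝ b) (hf : ∀ u, f u t = b (F.arcCoord t u)) (u : ℝ) :
    pS F.γ f u t = deriv b (F.arcCoord t u) := by
  have : deriv (fun v => f v t) u = F.speed u t • deriv b (F.arcCoord t u) := by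
    simp only [hf]
    exact ((hb _).hasDerivAt.scomp u (F.hasDerivAt_arcCoord ht u)).deriv
  rw [pS, this]
  exact inv_smul_smul₀ (F.speed_pos ht u).ne' _

end Slice

section Param

variable {F : SphereCSF D} {t : ℝ} {c : ℝ → EuclideanSpace ℝ (Fin 3)}

lemma deriv_slice_eq (ht : t ∈ D) (hc : IsSphericalUnitSpeed c)
    (hγ : ∀ u, F.γ u t = c (F.arcCoord t u)) (u : ℝ) :
    deriv (fun v => F.γ v t) u = F.speed u t • deriv c (F.arcCoord t u) := by
  simp only [hγ]
  exact ((hc.hasDerivAt _).scomp u (F.hasDerivAt_arcCoord ht u)).deriv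

lemma curvVec_eq (ht : t ∈ D) (hc : IsSphericalUnitSpeed c)
    (hγ : ∀ u, F.γ u t = c (F.arcCoord t u)) (u : ℝ) :
    curvVec F.γ u t = deriv (deriv c) (F.arcCoord t u) + c (F.arcCoord t u) := by
  rw [curvVec, F.pS_comp ht (hc.contDiff_deriv.differentiable (by simp))
    (F.pS_comp ht (hc.contDiff.differentiable (by simp)) hγ), hγ]

end Param

lemma param_periodic {F : SphereCSF D} {t : ℝ} (ht : t ∈ D) {c : ℝ → EuclideanSpace ℝ (Fin 3)}
    (hγ : ∀ u, F.γ u t = c (F.arcCoord t u)) (s : ℝ) : c (s + F.length t) = c s := by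
  obtain ⟨u, rfl⟩ := F.arcCoord_surjective ht s
  rw [← F.arcCoord_add_period ht, ← hγ, ← hγ]
  exact F.periodic t ht u

end SphereCSF

/-! ### Evolution of lengths -/

/-- Differentiation under the integral sign on a compact interval. -/
lemma hasDerivAt_intervalIntegral_of_contDiffOn {W : ℝ × ℝ → ℝ} {I : Set ℝ} (hI : IsOpen I)
    (hW : ContDiffOn ℝ 1 W (Set.univ ×ˢ I)) {t : ℝ} (ht : t ∈ I) (a b : ℝ) :
    HasDerivAt (fun s => ∫ u in a..b, W (u, s)) (∫ u in a..b, fderiv ℝ W (u, t) (0, 1)) t := by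
  have hopen : IsOpen ((Set.univ : Set ℝ) ×ˢ I) := isOpen_univ.prod hI
  have hcont : ∀ s ∈ I, Continuous fun u => W (u, s) := fun s hs =>
    continuousOn_univ.1 (hW.continuousOn.comp (f := fun u : ℝ => (u, s)) (by fun_prop)
      fun u _ => ⟨trivial, hs⟩)
  have hfd : ContinuousOn (fun p => fderiv ℝ W p (0, 1)) (Set.univ ×ˢ I) :=
    (hW.continuousOn_fderiv_of_isOpen hopen le_rfl).clm_apply continuousOn_const
  obtain ⟨ε, hε, hball⟩ := Metric.nhds_basis_closedBall.mem_iff.1 (hI.mem_nhds ht)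
  have hK : IsCompact (Set.uIcc a b ×ˢ Metric.closedBall t ε) :=
    isCompact_uIcc.prod (isCompact_closedBall _ _)
  obtain ⟨C, hC⟩ := hK.exists_bound_of_continuousOn
    (hfd.mono (Set.prod_mono (Set.subset_univ _) hball))
  refine (intervalIntegral.hasDerivAt_integral_of_dominated_loc_of_deriv_le
    (F' := fun s u => fderiv ℝ W (u, s) (0, 1)) (bound := fun _ => C)
    (Metric.closedBall_mem_nhds t hε) ?_ ((hcont t ht).intervalIntegrable _ _) ?_ ?_
    intervalIntegrable_const ?_).2
  · filter_upwards [hI.mem_nhds ht] with s hs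
    exact (hcont s hs).aestronglyMeasurable
  · exact (continuousOn_univ.1 (hfd.comp (f := fun u : ℝ => (u, t)) (by fun_prop)
      fun u _ => ⟨trivial, ht⟩)).aestronglyMeasurable
  · exact Filter.Eventually.of_forall fun u hu s hs =>
      hC (u, s) ⟨Set.uIoc_subset_uIcc hu, hs⟩
  · refine Filter.Eventually.of_forall fun u _ s hs => ?_
    have h1 : HasFDerivAt W (fderiv ℝ W (u, s)) (u, s) :=
      ((hW.contDiffAt (hopen.mem_nhds ⟨trivial, hball hs⟩)).differentiableAt (by simp)).hasFDerivAt
    exact h1.comp_hasDerivAt s ((hasDerivAt_const s u).prodMk (hasDerivAt_id s))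

namespace SphereCSF

section Evolution

variable {T : ℝ} (F : SphereCSF (Set.Ico 0 T))

lemma continuousOn_γ : ContinuousOn (fun p : ℝ × ℝ => F.γ p.1 p.2) (Set.univ ×ˢ Set.Ico 0 T) :=
  F.smooth.continuousOn

lemma deriv_slice_eq_fderivWithin {u t : ℝ} (ht : t ∈ Set.Ico 0 T) :
    deriv (fun v => F.γ v t) u = fderivWithin ℝ (fun p : ℝ × ℝ => F.γ p.1 p.2)
      (Set.univ ×ˢ Set.Ico 0 T) (u, t) (1, 0) := by
  have h1 := ((F.smooth.differentiableOn (by simp)) (u, t) ⟨trivial, ht⟩).hasFDerivWithinAt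
  exact (h1.comp_hasDerivAt_of_eq u ((hasDerivAt_id u).prodMk (hasDerivAt_const u t))
    (Filter.Eventually.of_forall fun v => ⟨trivial, ht⟩) rfl).deriv

lemma continuousOn_deriv_slice :
    ContinuousOn (fun p : ℝ × ℝ => deriv (fun v => F.γ v p.2) p.1)
      (Set.univ ×ˢ Set.Ico 0 T) :=
  (((F.smooth.continuousOn_fderivWithin (uniqueDiffOn_univ.prod (uniqueDiffOn_Ico 0 T))
    (by simp)).clm_apply (continuousOn_const (c := ((1 : ℝ), (0 : ℝ))))).congr
      fun p hp => F.deriv_slice_eq_fderivWithin hp.2)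

lemma continuousOn_speed :
    ContinuousOn (fun p : ℝ × ℝ => F.speed p.1 p.2) (Set.univ ×ˢ Set.Ico 0 T) :=
  F.continuousOn_deriv_slice.norm

lemma continuousOn_arcCoord :
    ContinuousOn (fun p : ℝ × ℝ => F.arcCoord p.2 p.1) (Set.univ ×ˢ Set.Ico 0 T) := by
  have h1 : Continuous (Function.uncurry fun (s : Set.Ico 0 T) (w : ℝ) => F.speed w s) :=
    F.continuousOn_speed.comp_continuous (f := fun p : Set.Ico 0 T × ℝ => (p.2, (p.1 : ℝ)))
      (by fun_prop) fun p => ⟨trivial, p.1.2⟩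
  have h2 := intervalIntegral.continuous_parametric_primitive_of_continuous (μ := volume)
    (a₀ := 0) h1
  rw [continuousOn_iff_continuous_domRestrict]
  exact h2.comp (f := fun p : ((Set.univ : Set ℝ) ×ˢ Set.Ico 0 T : Set (ℝ × ℝ)) =>
    ((⟨p.1.2, p.2.2⟩ : Set.Ico 0 T), p.1.1)) (by fun_prop)

lemma continuousOn_length : ContinuousOn F.length (Set.Ico 0 T) :=
  F.continuousOn_arcCoord.comp (f := fun t : ℝ => (2 * π, t)) (by fun_prop)
    fun t ht => ⟨trivial, ht⟩

lemma contDiffAt_γ {u t : ℝ} (ht : t ∈ Set.Ioo 0 T) :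
    ContDiffAt ℝ (⊤ : ℕ∞) (fun p : ℝ × ℝ => F.γ p.1 p.2) (u, t) :=
  F.smooth.contDiffAt (Filter.mem_of_superset
    ((isOpen_univ.prod isOpen_Ioo).mem_nhds ⟨trivial, ht⟩)
    (Set.prod_mono subset_rfl Set.Ioo_subset_Ico_self))

lemma hasDerivAt_flow {u t : ℝ} (ht : t ∈ Set.Ioo 0 T) :
    HasDerivAt (fun s => F.γ u s) (curvVec F.γ u t) t :=
  (F.flow t (Set.Ioo_subset_Ico_self ht) u).hasDerivAt (Ico_mem_nhds ht.1 ht.2)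

lemma deriv_slice_eq_fderiv {u t : ℝ} (ht : t ∈ Set.Ioo 0 T) :
    deriv (fun v => F.γ v t) u = fderiv ℝ (fun p : ℝ × ℝ => F.γ p.1 p.2) (u, t) (1, 0) :=
  (HasFDerivAt.comp_hasDerivAt (f := fun v : ℝ => (v, t)) u
    ((F.contDiffAt_γ ht).differentiableAt (by simp)).hasFDerivAt
    ((hasDerivAt_id u).prodMk (hasDerivAt_const u t))).deriv

lemma fderiv_time_eq {u t : ℝ} (ht : t ∈ Set.Ioo 0 T) :
    fderiv ℝ (fun p : ℝ × ℝ => F.γ p.1 p.2) (u, t) (0, 1) = curvVec F.γ u t :=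
  (((F.contDiffAt_γ ht).differentiableAt (by simp)).hasFDerivAt.comp_hasDerivAt t
    ((hasDerivAt_const t u).prodMk (hasDerivAt_id t))).unique (F.hasDerivAt_flow ht)

lemma contDiffAt_fderiv_γ {u t : ℝ} (ht : t ∈ Set.Ioo 0 T) :
    ContDiffAt ℝ (⊤ : ℕ∞) (fderiv ℝ (fun p : ℝ × ℝ => F.γ p.1 p.2)) (u, t) :=
  (F.contDiffAt_γ ht).fderiv_right (by simp)

lemma hasDerivAt_deriv_slice {u t : ℝ} (ht : t ∈ Set.Ioo 0 T) :
    HasDerivAt (fun s => deriv (fun v => F.γ v s) u) (deriv (fun v => curvVec F.γ v t) u) t := by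
  set G : ℝ × ℝ → EuclideanSpace ℝ (Fin 3) := fun p => F.γ p.1 p.2 with hG
  have hD : HasFDerivAt (fderiv ℝ G) (fderiv ℝ (fderiv ℝ G) (u, t)) (u, t) :=
    ((F.contDiffAt_fderiv_γ ht).differentiableAt (by simp)).hasFDerivAt
  have hsymm : IsSymmSndFDerivAt ℝ G (u, t) :=
    (F.contDiffAt_γ ht).isSymmSndFDerivAt (by simpa using WithTop.coe_le_coe.2 (le_top : (2 : ℕ∞) ≤ ⊤))
  have h1 : HasDerivAt (fun s => fderiv ℝ G (u, s) (1, 0))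
      (fderiv ℝ (fderiv ℝ G) (u, t) (0, 1) (1, 0)) t := by
    have := HasFDerivAt.comp_hasDerivAt (f := fun s : ℝ => (u, s)) t hD
      ((hasDerivAt_const t u).prodMk (hasDerivAt_id t))
    simpa using this.clm_apply (hasDerivAt_const t ((1 : ℝ), (0 : ℝ)))
  have h2 : HasDerivAt (fun v => fderiv ℝ G (v, t) (0, 1))
      (fderiv ℝ (fderiv ℝ G) (u, t) (1, 0) (0, 1)) u := by
    have := HasFDerivAt.comp_hasDerivAt (f := fun v : ℝ => (v, t)) u hD
      ((hasDerivAt_id u).prodMk (hasDerivAt_const u t))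
    simpa using this.clm_apply (hasDerivAt_const u ((0 : ℝ), (1 : ℝ)))
  have h3 : deriv (fun v => curvVec F.γ v t) u = fderiv ℝ (fderiv ℝ G) (u, t) (1, 0) (0, 1) := by
    rw [← h2.deriv]
    congr 1
    ext1 v
    exact (F.fderiv_time_eq ht).symm
  rw [h3, hsymm]
  refine h1.congr_of_eventuallyEq ?_
  filter_upwards [isOpen_Ioo.mem_nhds ht] with s hs
  exact F.deriv_slice_eq_fderiv hs

lemma contDiffOn_speed :
    ContDiffOn ℝ 1 (fun p : ℝ × ℝ => F.speed p.1 p.2) (Set.univ ×ˢ Set.Ioo 0 T) := by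
  have hopen : IsOpen ((Set.univ : Set ℝ) ×ˢ Set.Ioo 0 T) := isOpen_univ.prod isOpen_Ioo
  rintro ⟨u, t⟩ ⟨-, ht⟩
  refine ContDiffAt.contDiffWithinAt ?_
  have h1 : ContDiffAt ℝ 1 (fun p : ℝ × ℝ =>
      fderiv ℝ (fun p : ℝ × ℝ => F.γ p.1 p.2) p (1, 0)) (u, t) :=
    ((F.contDiffAt_fderiv_γ ht).of_le (by simp)).clm_apply contDiffAt_const
  have h2 : fderiv ℝ (fun p : ℝ × ℝ => F.γ p.1 p.2) (u, t) (1, 0) ≠ 0 := by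
    rw [← F.deriv_slice_eq_fderiv ht]
    exact F.regular t (Set.Ioo_subset_Ico_self ht) u
  refine (h1.norm ℝ h2).congr_of_eventuallyEq ?_
  filter_upwards [hopen.mem_nhds ⟨trivial, ht⟩] with p hp
  rw [speed, F.deriv_slice_eq_fderiv hp.2]

variable {F} {t : ℝ} {c : ℝ → EuclideanSpace ℝ (Fin 3)}

lemma hasDerivAt_speed (ht : t ∈ Set.Ioo 0 T) (hc : IsSphericalUnitSpeed c)
    (hγ : ∀ u, F.γ u t = c (F.arcCoord t u)) (u : ℝ) :
    HasDerivAt (fun s => F.speed u s)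
      ((1 - ‖deriv (deriv c) (F.arcCoord t u)‖ ^ 2) * F.speed u t) t := by
  have ht' := Set.Ioo_subset_Ico_self ht
  have h1 := F.hasDerivAt_deriv_slice (u := u) ht
  have h2 : deriv (fun v => curvVec F.γ v t) u = F.speed u t •
      (deriv (deriv (deriv c)) (F.arcCoord t u) + deriv c (F.arcCoord t u)) := by
    simp only [curvVec_eq ht' hc hγ]
    exact (((hc.hasDerivAt_deriv_deriv _).add (hc.hasDerivAt _)).scomp u
      (F.hasDerivAt_arcCoord ht' u)).deriv
  rw [h2] at h1
  have h3 := (h1.norm_sq).sqrt (by simpa using F.regular t ht' u)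
  simp only [sqrt_sq (norm_nonneg _)] at h3
  refine h3.congr_deriv ?_
  rw [deriv_slice_eq ht' hc hγ, inner_smul_left, inner_smul_right, inner_add_right,
    hc.inner_deriv_third, real_inner_self_eq_norm_sq, norm_smul, hc.norm_deriv,
    norm_eq_abs, abs_of_pos (F.speed_pos ht' u)]
  have := (F.speed_pos ht' u).ne'
  simp only [conj_trivial]
  field_simp
  ring

/-- Evolution of the length of an arc with fixed parameter endpoints. -/
lemma hasDerivAt_arc (ht : t ∈ Set.Ioo 0 T) (hc : IsSphericalUnitSpeed c)
    (hγ : ∀ u, F.γ u t = c (F.arcCoord t u)) (u v : ℝ) :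
    HasDerivAt (fun s => F.arcCoord s v - F.arcCoord s u)
      (F.arcCoord t v - F.arcCoord t u
        - ∫ x in F.arcCoord t u..F.arcCoord t v, ‖deriv (deriv c) x‖ ^ 2) t := by
  have ht' := Set.Ioo_subset_Ico_self ht
  have hk : Continuous fun x => ‖deriv (deriv c) x‖ ^ 2 :=
    (hc.contDiff_deriv_deriv.continuous.norm).pow 2
  have h1 := hasDerivAt_intervalIntegral_of_contDiffOn isOpen_Ioo F.contDiffOn_speed ht u v
  have h2 : ∀ w, fderiv ℝ (fun p : ℝ × ℝ => F.speed p.1 p.2) (w, t) (0, 1)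
      = (1 - ‖deriv (deriv c) (F.arcCoord t w)‖ ^ 2) * F.speed w t := by
    intro w
    have h3 : HasFDerivAt (fun p : ℝ × ℝ => F.speed p.1 p.2)
        (fderiv ℝ (fun p : ℝ × ℝ => F.speed p.1 p.2) (w, t)) (w, t) :=
      ((F.contDiffOn_speed.contDiffAt ((isOpen_univ.prod isOpen_Ioo).mem_nhds
        ⟨trivial, ht⟩)).differentiableAt (by simp)).hasFDerivAt
    exact (h3.comp_hasDerivAt t ((hasDerivAt_const t w).prodMk (hasDerivAt_id t))).unique
      (hasDerivAt_speed ht hc hγ w)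
  simp only [h2] at h1
  have h4 := intervalIntegral.integral_comp_mul_deriv (a := u) (b := v)
    (f := F.arcCoord t) (f' := fun w => F.speed w t)
    (g := fun x => 1 - ‖deriv (deriv c) x‖ ^ 2)
    (fun w _ => F.hasDerivAt_arcCoord ht' w) (F.continuous_speed_slice ht').continuousOn
    (continuous_const.sub hk)
  simp only [Function.comp_def] at h4
  rw [h4, intervalIntegral.integral_sub intervalIntegrable_const (hk.intervalIntegrable _ _),
    intervalIntegral.integral_const, smul_eq_mul, mul_one] at h1
  refine h1.congr_of_eventuallyEq ?_
  filter_upwards [isOpen_Ioo.mem_nhds ht] with s hs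
  exact (F.integral_speed (Set.Ioo_subset_Ico_self hs) u v).symm

/-- Evolution of the total length. -/
lemma hasDerivAt_length (ht : t ∈ Set.Ioo 0 T) (hc : IsSphericalUnitSpeed c)
    (hγ : ∀ u, F.γ u t = c (F.arcCoord t u)) :
    HasDerivAt F.length
      (F.length t - ∫ x in (0 : ℝ)..F.length t, ‖deriv (deriv c) x‖ ^ 2) t := by
  have h0 : ∀ s, F.arcCoord s 0 = 0 := fun s => intervalIntegral.integral_same
  have := hasDerivAt_arc ht hc hγ 0 (2 * π)
  simp only [h0, sub_zero] at this
  exact this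

end Evolution

end SphereCSF

/-! ### The static inequality at a touching pair -/

namespace IsSphericalUnitSpeed

variable {c : ℝ → EuclideanSpace ℝ (Fin 3)} {L : ℝ}

lemma continuous_norm_deriv_deriv (h : IsSphericalUnitSpeed c) :
    Continuous fun s => ‖deriv (deriv c) s‖ := h.contDiff_deriv_deriv.continuous.norm

lemma sub_le_integral_sq (h : IsSphericalUnitSpeed c) {x y : ℝ} (hxy : x ≤ y) :
    y - x ≤ ∫ s in x..y, ‖deriv (deriv c) s‖ ^ 2 := by
  have := intervalIntegral.integral_mono_on (f := fun _ => (1 : ℝ)) hxy intervalIntegrable_const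
    ((h.continuous_norm_deriv_deriv.pow 2).intervalIntegrable (μ := volume) x y)
    (fun s _ => one_le_pow₀ (h.one_le_norm_deriv_deriv s))
  simpa using this

lemma four_pi_sq_le (h : IsSphericalUnitSpeed c) (hL : 0 < L) (hper : ∀ s, c (s + L) = c s) :
    4 * π ^ 2 ≤ L * ∫ s in (0 : ℝ)..L, ‖deriv (deriv c) s‖ ^ 2 := by
  refine wirtinger_unit hL h.hasDerivAt_deriv h.contDiff_deriv_deriv.continuous ?_ ?_ h.norm_deriv
  · have hd : ∀ s, deriv c (s + L) = deriv c s := fun s => by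
      rw [← deriv_comp_add_const]
      exact congrArg (fun f => deriv f s) (funext hper)
    simpa using hd 0
  · rw [intervalIntegral.integral_eq_sub_of_hasDerivAt (fun s _ => h.hasDerivAt s)
      (h.contDiff_deriv.continuous.intervalIntegrable _ _)]
    have := hper 0
    rw [zero_add] at this
    rw [this, sub_self]

set_option maxHeartbeats 1000000 in
/-- At a pair of points where the chord touches `μ L f(ℓ / L)` from above, the evolution of
chord minus profile is nonnegative. -/
lemma touching_evolution_nonneg (h : IsSphericalUnitSpeed c) (hL : 0 < L)
    (hper : ∀ s, c (s + L) = c s) {a μ x y : ℝ} (ha : 0 < a) (hμ0 : 0 < μ) (hμ1 : μ ≤ 1)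
    (hxy : x < y) (hhalf : (y - x) / L ≤ 1 / 2)
    (heq : ‖c y - c x‖ = μ * (L * chordProfile a ((y - x) / L)))
    (hle : ∀ᶠ p in nhds (x, y),
      μ * (L * chordProfile a ((p.2 - p.1) / L)) ≤ ‖c p.2 - c p.1‖) :
    μ * ((L - ∫ s in (0 : ℝ)..L, ‖deriv (deriv c) s‖ ^ 2) * chordProfile a ((y - x) / L)
      + L * (chordProfileDeriv a ((y - x) / L) * (((y - x - ∫ s in x..y, ‖deriv (deriv c) s‖ ^ 2) * L
        - (y - x) * (L - ∫ s in (0 : ℝ)..L, ‖deriv (deriv c) s‖ ^ 2)) / L ^ 2)))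
      ≤ inner ℝ (c y - c x) (deriv (deriv c) y - deriv (deriv c) x) / ‖c y - c x‖
        + ‖c y - c x‖ := by
  set ℓ := y - x with hℓ
  set σ := ℓ / L with hσ
  have hℓpos : 0 < ℓ := sub_pos.2 hxy
  have hσ0 : 0 < σ := by positivity
  have hf := chordProfile_pos ha hσ0 (by linarith)
  have hf' := chordProfileDeriv_nonneg (a := a) hσ0.le hhalf
  have hff' := mul_chordProfileDeriv_le_chordProfile ha hσ0.le hhalf
  set f := chordProfile a σ with hfdef
  set f' := chordProfileDeriv a σ with hfdef'
  set K := ∫ s in (0 : ℝ)..L, ‖deriv (deriv c) s‖ ^ 2 with hK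
  set k := ∫ s in x..y, ‖deriv (deriv c) s‖ ^ 2 with hk
  set d := ‖c y - c x‖ with hd
  have hdpos : 0 < d := by rw [heq]; positivity
  have hℓσ : ℓ = σ * L := by rw [hσ]; field_simp
  have hlhs : μ * ((L - K) * f + L * (f' * (((ℓ - k) * L - ℓ * (L - K)) / L ^ 2)))
      = d - K * (μ * f - σ * (μ * f')) - μ * f' * k := by
    rw [heq, hℓσ]; field_simp; ring
  have hKL : L ≤ K := by simpa using h.sub_le_integral_sq hL.le
  have hkl : ℓ ≤ k := h.sub_le_integral_sq hxy.le
  have hLK := h.four_pi_sq_le hL hper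
  rw [hlhs]
  have hlin : ∀ z : ℝ, HasDerivAt (fun z => z / L) (1 / L) z := fun z => (hasDerivAt_id z).div_const L
  have hH : ∀ z, HasDerivAt (fun z => μ * (L * chordProfile a (z / L)))
      (μ * chordProfileDeriv a (z / L)) z := fun z => by
    refine ((((hasDerivAt_chordProfile ha (z / L)).comp z (hlin z)).const_mul L).const_mul
      μ).congr_deriv ?_
    field_simp
  have hH' : HasDerivAt (fun z => μ * chordProfileDeriv a (z / L))
      (μ * (chordProfileDerivTwo a (ℓ / L) * (1 / L))) (y - x) :=
    (HasDerivAt.comp (h := fun z => z / L) ℓ (hasDerivAt_chordProfileDeriv (ℓ / L))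
      (hlin ℓ)).const_mul μ
  have hg0 : 0 ≤ μ * f - σ * (μ * f') := by nlinarith
  have hg1 : 0 ≤ μ * f' := by positivity
  rcases h.chord_touching hH hH' (by rw [← heq]; exact hdpos) heq hle with hA | ⟨hB, hT⟩
  · have h1 : -d ≤ inner ℝ (c y - c x) (deriv (deriv c) y - deriv (deriv c) x) / d := by
      rw [le_div_iff₀ hdpos]; nlinarith
    have h2 : L * (μ * f - σ * (μ * f')) ≤ K * (μ * f - σ * (μ * f')) := by gcongr
    have h3 : μ * f' * ℓ ≤ μ * f' * k := by gcongr
    have h4 : L * (μ * f - σ * (μ * f')) + μ * f' * ℓ = d := by rw [heq, hℓσ]; ring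
    linarith
  · have h1 : 4 * (μ * (chordProfileDerivTwo a σ * (1 / L)))
        ≤ inner ℝ (c y - c x) (deriv (deriv c) y - deriv (deriv c) x) / d := by
      rw [le_div_iff₀ hdpos]
      simp only [← hℓ, ← hσ, ← hfdef] at hB
      rw [← heq] at hB
      linarith
    have h2 := two_mul_arccos_le_integral hxy h.hasDerivAt_deriv
      h.contDiff_deriv_deriv.continuous h.norm_deriv hg1 hT
    have h3 := sq_integral_le h.continuous_norm_deriv_deriv hxy
    rw [← hℓ, ← hk] at h3
    have h4 : 4 * arccos (μ * f') ^ 2 ≤ ℓ * k := by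
      have : (2 * arccos (μ * f')) ^ 2 ≤ (∫ s in x..y, ‖deriv (deriv c) s‖) ^ 2 := by
        have := arccos_nonneg (μ * f')
        gcongr
      nlinarith
    have h5 := chordProfile_differential_ineq ha hμ0.le hμ1 hσ0 hhalf
    have h6 : μ * f' * arccos (μ * f') ^ 2 / σ ≤ L * (μ * f' * k) / 4 := by
      rw [div_le_iff₀ hσ0]
      rw [hℓσ] at h4
      linarith [mul_le_mul_of_nonneg_left h4 hg1]
    have h7 : π ^ 2 * (μ * f - σ * (μ * f')) ≤ L * (K * (μ * f - σ * (μ * f'))) / 4 := by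
      linarith [mul_le_mul_of_nonneg_right hLK hg0]
    have h8 : 0 ≤ L * (4 * (μ * (chordProfileDerivTwo a σ * (1 / L)))
        + K * (μ * f - σ * (μ * f')) + μ * f' * k) := by
      have : L * (4 * (μ * (chordProfileDerivTwo a σ * (1 / L))))
          = 4 * (μ * chordProfileDerivTwo a σ) := by field_simp
      rw [mul_add, mul_add, this]
      linarith
    have h9 := nonneg_of_mul_nonneg_right h8 hL
    linarith

end IsSphericalUnitSpeed

/-! ### The chord-arc comparison along the flow -/

/-- A property of pairs of points on a circle of length `2π`, invariant under exchanging the two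
points, may be checked on pairs `(u, v)` with `0 ≤ u < 2π` and `u < v ≤ u + π`. -/
lemma forall_pairs_of_half {P : ℝ → ℝ → Prop}
    (hswap : ∀ u v, P v (u + 2 * π) ↔ P u v)
    (hP : ∀ u ∈ Set.Ico 0 (2 * π), ∀ v ∈ Set.Ioc u (u + π), P u v)
    {u v : ℝ} (huv : u < v) (hvu : v < u + 2 * π) : P u v := by
  have hshift : ∀ u v, P (u + 2 * π) (v + 2 * π) ↔ P u v := fun u v => by rw [hswap, hswap]
  have hshift_int : ∀ (n : ℤ) (u v : ℝ), P (u + n * (2 * π)) (v + n * (2 * π)) ↔ P u v := by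
    intro n
    induction n using Int.induction_on with
    | zero => simp
    | succ n ih =>
      intro u v
      rw [← ih u v, ← hshift (u + (n : ℤ) * (2 * π))]
      push_cast
      ring_nf
    | pred n ih =>
      intro u v
      rw [← ih u v, ← hshift (u + ((-n - 1 : ℤ) : ℝ) * (2 * π))]
      push_cast
      ring_nf
  have hshort : ∀ {u v : ℝ}, u < v → v ≤ u + π → P u v := by
    intro u v huv hvu
    set n := ⌊u / (2 * π)⌋ with hn
    have hpi : (0 : ℝ) < 2 * π := by positivity
    have h1 : (n : ℝ) * (2 * π) ≤ u := (le_div_iff₀ hpi).1 (Int.floor_le _)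
    have h2 : u < (n + 1) * (2 * π) := (div_lt_iff₀ hpi).1 (Int.lt_floor_add_one _)
    have := hP (u - n * (2 * π)) ⟨by linarith, by linarith⟩ (v - n * (2 * π))
      ⟨by linarith, by linarith⟩
    rw [← hshift_int n] at this
    simpa using this
  rcases le_total v (u + π) with h | h
  · exact hshort huv h
  · rw [← hswap]
    exact hshort hvu (by linarith)

namespace SphereCSF

/-- The model chord length `L f(ℓ / L)` for the arc from parameter `u` to parameter `v`. -/
def profile (F : SphereCSF D) (a t u v : ℝ) : ℝ :=
  F.length t * chordProfile a ((F.arcCoord t v - F.arcCoord t u) / F.length t)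

lemma profile_swap (F : SphereCSF D) {t : ℝ} (ht : t ∈ D) (a u v : ℝ) :
    F.profile a t v (u + 2 * π) = F.profile a t u v := by
  have hL := (F.length_pos ht).ne'
  rw [profile, profile, F.arcCoord_add_period ht, ← chordProfile_one_sub]
  congr 2
  field_simp
  ring

lemma chord_swap (F : SphereCSF D) {t : ℝ} (ht : t ∈ D) (u v : ℝ) :
    ‖F.γ (u + 2 * π) t - F.γ v t‖ = ‖F.γ v t - F.γ u t‖ := by
  have := F.periodic t ht u
  simp only at this
  rw [this, norm_sub_rev]

lemma arc_pos (F : SphereCSF D) {t : ℝ} (ht : t ∈ D) {u v : ℝ} (huv : u < v) :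
    0 < F.arcCoord t v - F.arcCoord t u := sub_pos.2 (F.arcCoord_strictMono ht huv)

lemma arc_lt_length (F : SphereCSF D) {t : ℝ} (ht : t ∈ D) {u v : ℝ} (hvu : v < u + 2 * π) :
    F.arcCoord t v - F.arcCoord t u < F.length t := by
  have := F.arcCoord_strictMono ht hvu
  rw [F.arcCoord_add_period ht] at this
  linarith

lemma profile_pos (F : SphereCSF D) {t : ℝ} (ht : t ∈ D) {a u v : ℝ} (ha : 0 < a) (huv : u < v)
    (hvu : v < u + 2 * π) : 0 < F.profile a t u v := by
  have hL := F.length_pos ht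
  exact mul_pos hL (chordProfile_pos ha (div_pos (F.arc_pos ht huv) hL)
    ((div_lt_one hL).2 (F.arc_lt_length ht hvu)))

lemma profile_le_arc (F : SphereCSF D) {t : ℝ} (ht : t ∈ D) {a u v : ℝ} (ha : 0 < a) (huv : u < v)
    (hvu : v < u + 2 * π) : F.profile a t u v ≤ F.arcCoord t v - F.arcCoord t u := by
  have hL := F.length_pos ht
  have := mul_le_mul_of_nonneg_left (chordProfile_le_self ha
    (div_pos (F.arc_pos ht huv) hL).le ((div_lt_one hL).2 (F.arc_lt_length ht hvu)).le) hL.le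
  rwa [mul_div_cancel₀ _ hL.ne'] at this

section MaximumPrinciple

variable {T : ℝ} {F : SphereCSF (Set.Ico 0 T)} {a ε : ℝ}

lemma hasDerivAt_gap_pos_of_half (ha : 0 < a) (hε : 0 < ε) {t : ℝ} (ht : t ∈ Set.Ioo 0 T)
    {u v : ℝ} (huv : u < v) (hvu : v < u + 2 * π)
    (hhalf : (F.arcCoord t v - F.arcCoord t u) / F.length t ≤ 1 / 2)
    (heq : ‖F.γ v t - F.γ u t‖ = exp (-ε * (1 + t)) * F.profile a t u v)
    (hle : ∀ p q, p < q → q < p + 2 * π →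
      exp (-ε * (1 + t)) * F.profile a t p q ≤ ‖F.γ q t - F.γ p t‖) :
    ∃ δ > 0, HasDerivAt (fun s => ‖F.γ v s - F.γ u s‖ - exp (-ε * (1 + s)) * F.profile a s u v)
      δ t := by
  have ht' := Set.Ioo_subset_Ico_self ht
  obtain ⟨c, hc, hγ⟩ := F.exists_arclength_param ht'
  have hL := F.length_pos ht'
  set μ := exp (-ε * (1 + t)) with hμ
  have hμ0 : 0 < μ := exp_pos _
  have hμ1 : μ ≤ 1 := exp_le_one_iff.2 (by nlinarith [ht.1])
  have hprof := F.profile_pos ht' ha huv hvu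
  have hpos : 0 < ‖F.γ v t - F.γ u t‖ := by rw [heq]; positivity
  have hmono := F.arcCoord_strictMono ht'
  have key := hc.touching_evolution_nonneg hL (param_periodic ht' hγ) ha hμ0 hμ1
    (hmono huv) hhalf (by rw [← hγ, ← hγ, heq]; rfl) (by
      have h1 : ∀ᶠ p : ℝ × ℝ in nhds (F.arcCoord t u, F.arcCoord t v),
          p.1 < p.2 ∧ p.2 < p.1 + F.length t := by
        refine ((isOpen_lt continuous_fst continuous_snd).inter (isOpen_lt continuous_snd
          (continuous_fst.add continuous_const))).mem_nhds ⟨hmono huv, ?_⟩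
        have := F.arc_lt_length ht' hvu
        change F.arcCoord t v < F.arcCoord t u + F.length t
        linarith
      filter_upwards [h1] with p hp
      obtain ⟨p', hp'⟩ := F.arcCoord_surjective ht' p.1
      obtain ⟨q', hq'⟩ := F.arcCoord_surjective ht' p.2
      rw [← hp', ← hq', ← F.arcCoord_add_period ht'] at hp
      have := hle p' q' (hmono.lt_iff_lt.1 hp.1) (hmono.lt_iff_lt.1 hp.2)
      rw [hγ, hγ, profile, hp', hq'] at this
      exact this)
  have hLd := hasDerivAt_length ht hc hγ
  have hℓd := hasDerivAt_arc ht hc hγ u v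
  have hprofd := hLd.mul ((hasDerivAt_chordProfile ha _).comp t (hℓd.div hLd hL.ne'))
  have hexp : HasDerivAt (fun s => exp (-ε * (1 + s))) (μ * (-ε * 1)) t :=
    (((hasDerivAt_id t).const_add 1).const_mul (-ε)).exp
  have hchord := ((F.hasDerivAt_flow (u := v) ht).sub (F.hasDerivAt_flow (u := u) ht)).norm_sq.sqrt
    (by simpa using (norm_pos_iff.1 hpos))
  simp only [sqrt_sq (norm_nonneg _)] at hchord
  have hsum := hchord.sub (hexp.mul hprofd)
  refine ⟨_, ?_, hsum⟩
  simp only [Pi.sub_apply, Pi.mul_apply, Function.comp_def, Pi.div_apply]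
  rw [← hμ, curvVec_eq ht' hc hγ, curvVec_eq ht' hc hγ, hγ, hγ,
    show ∀ p q r s : EuclideanSpace ℝ (Fin 3), p + q - (r + s) = (p - r) + (q - s) from
      fun p q r s => by abel, inner_add_right, real_inner_self_eq_norm_sq]
  rw [hγ, hγ] at hpos
  have h2 : ∀ A B : ℝ, 0 < B → 2 * (A + B ^ 2) / (2 * B) = A / B + B := by
    intro A B hB; field_simp
  rw [h2 _ _ hpos]
  have h3 : 0 < μ * ε * F.profile a t u v := by positivity
  rw [profile] at h3
  linarith

lemma hasDerivAt_gap_pos (ha : 0 < a) (hε : 0 < ε) {t : ℝ} (ht : t ∈ Set.Ioo 0 T)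
    {u v : ℝ} (huv : u < v) (hvu : v < u + 2 * π)
    (heq : ‖F.γ v t - F.γ u t‖ = exp (-ε * (1 + t)) * F.profile a t u v)
    (hle : ∀ p q, p < q → q < p + 2 * π →
      exp (-ε * (1 + t)) * F.profile a t p q ≤ ‖F.γ q t - F.γ p t‖) :
    ∃ δ > 0, HasDerivAt (fun s => ‖F.γ v s - F.γ u s‖ - exp (-ε * (1 + s)) * F.profile a s u v)
      δ t := by
  have ht' := Set.Ioo_subset_Ico_self ht
  have hL := F.length_pos ht'
  rcases le_total ((F.arcCoord t v - F.arcCoord t u) / F.length t) (1 / 2) with h | h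
  · exact hasDerivAt_gap_pos_of_half ha hε ht huv hvu h heq hle
  · obtain ⟨δ, hδ, hd⟩ := hasDerivAt_gap_pos_of_half (F := F) ha hε ht (u := v) (v := u + 2 * π)
      hvu (by linarith) (by
        rw [div_le_iff₀ hL, F.arcCoord_add_period ht']
        rw [le_div_iff₀ hL] at h
        linarith) (by rwa [F.profile_swap ht', F.chord_swap ht']) hle
    refine ⟨δ, hδ, hd.congr_of_eventuallyEq ?_⟩
    filter_upwards [isOpen_Ioo.mem_nhds ht] with s hs
    rw [F.profile_swap (Set.Ioo_subset_Ico_self hs), F.chord_swap (Set.Ioo_subset_Ico_self hs)]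

end MaximumPrinciple

section ChordArc

variable {T : ℝ} {F : SphereCSF (Set.Ico 0 T)} {a : ℝ}

/-- The comparison holds strictly near the diagonal, locally uniformly in time. -/
lemma exists_near_diagonal (ha : 0 < a) {ρ : ℝ} (hρ0 : 0 ≤ ρ) (hρ1 : ρ < 1) {t₁ : ℝ}
    (ht₁ : t₁ ∈ Set.Ico 0 T) :
    ∃ δ > 0, ∀ t ∈ Set.Icc 0 t₁, ∀ u ∈ Set.Icc 0 (2 * π), ∀ v ∈ Set.Ioo u (u + δ),
      ρ * F.profile a t u v < ‖F.γ v t - F.γ u t‖ := by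
  have hpi := pi_pos
  set K : Set (ℝ × ℝ) := Set.Icc 0 (4 * π) ×ˢ Set.Icc 0 t₁ with hKdef
  have hK : IsCompact K := isCompact_Icc.prod isCompact_Icc
  have hKsub : K ⊆ Set.univ ×ˢ Set.Ico 0 T := fun p hp =>
    ⟨trivial, hp.2.1, hp.2.2.trans_lt ht₁.2⟩
  obtain ⟨p₀, hp₀, hmin⟩ := hK.exists_isMinOn
    ⟨(0, 0), ⟨⟨le_rfl, by positivity⟩, ⟨le_rfl, ht₁.1⟩⟩⟩ (F.continuousOn_speed.mono hKsub)
  set m := F.speed p₀.1 p₀.2 with hm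
  have hmpos : 0 < m := F.speed_pos (hKsub hp₀).2 _
  set ω := m * (1 - ρ) / 4 with hω
  have hωpos : 0 < ω := by have := sub_pos.2 hρ1; positivity
  obtain ⟨δ, hδ, hunif⟩ := Metric.uniformContinuousOn_iff.1
    (hK.uniformContinuousOn_of_continuous (F.continuousOn_deriv_slice.mono hKsub)) ω hωpos
  refine ⟨min δ (2 * π), by positivity, fun t ht u hu v hv => ?_⟩
  have ht' : t ∈ Set.Ico 0 T := ⟨ht.1, ht.2.trans_lt ht₁.2⟩
  have hvδ : v < u + δ := hv.2.trans_le (by gcongr; exact min_le_left _ _)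
  have hvpi : v < u + 2 * π := hv.2.trans_le (by gcongr; exact min_le_right _ _)
  have hKmem : ∀ w ∈ Set.Icc u v, (w, t) ∈ K := fun w hw =>
    ⟨⟨hu.1.trans hw.1, by linarith [hw.2, hu.2]⟩, ht⟩
  have huv := Set.left_mem_Icc.2 hv.1.le
  have hvv := Set.right_mem_Icc.2 hv.1.le
  set e := deriv (fun v => F.γ v t) u with he
  have hclose : ∀ w ∈ Set.Icc u v, ‖deriv (fun v => F.γ v t) w - e‖ ≤ ω := by
    intro w hw
    have := hunif (w, t) (hKmem w hw) (u, t) (hKmem u huv) (by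
      rw [Prod.dist_eq, dist_self, max_eq_left dist_nonneg, dist_eq, abs_of_nonneg (by linarith [hw.1])]
      linarith [hw.2])
    rw [dist_eq_norm] at this
    exact this.le
  have hs : m ≤ F.speed u t := isMinOn_iff.1 hmin (u, t) (hKmem u huv)
  change m ≤ ‖e‖ at hs
  have hvu : 0 < v - u := sub_pos.2 hv.1
  have hchord : ‖F.γ v t - F.γ u t - (v - u) • e‖ ≤ ω * (v - u) := by
    have := (convex_Icc u v).norm_image_sub_le_of_norm_hasDerivWithin_le
      (f := fun w => F.γ w t - w • e) (f' := fun w => deriv (fun v => F.γ v t) w - e) (C := ω)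
      (fun w _ => by
        have h1 := ((F.contDiff_slice ht').differentiable (by simp) w).hasDerivAt
        have h2 := (hasDerivAt_id w).smul_const e
        rw [one_smul] at h2
        exact (h1.sub h2).hasDerivWithinAt) hclose huv hvv
    rw [norm_eq_abs, abs_of_pos hvu] at this
    refine le_trans (le_of_eq ?_) this
    congr 1
    simp only [sub_smul]
    abel
  have hlow : (v - u) * (‖e‖ - ω) ≤ ‖F.γ v t - F.γ u t‖ := by
    have h1 : ‖(v - u) • e‖ = (v - u) * ‖e‖ := by rw [norm_smul, norm_eq_abs, abs_of_pos hvu]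
    have h2 := norm_sub_norm_le ((v - u) • e) (F.γ v t - F.γ u t)
    rw [h1, norm_sub_rev ((v - u) • e)] at h2
    linarith
  have harc : F.arcCoord t v - F.arcCoord t u ≤ (v - u) * (‖e‖ + ω) := by
    rw [← F.integral_speed ht']
    have := intervalIntegral.integral_mono_on (g := fun _ => ‖e‖ + ω) hv.1.le
      ((F.continuous_speed_slice ht').intervalIntegrable (μ := volume) u v)
      intervalIntegrable_const (fun w hw => by
        have h1 := norm_sub_norm_le (deriv (fun v => F.γ v t) w) e
        have h2 := hclose w hw
        simp only [speed]
        linarith)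
    rw [intervalIntegral.integral_const, smul_eq_mul] at this
    exact this
  have hprof := (F.profile_le_arc ht' ha hv.1 hvpi).trans harc
  have h1 : ρ * F.profile a t u v ≤ ρ * ((v - u) * (‖e‖ + ω)) := by gcongr
  refine h1.trans_lt (lt_of_lt_of_le ?_ hlow)
  have h2 : ρ * (‖e‖ + ω) < ‖e‖ - ω := by nlinarith
  nlinarith

/-- The chord-arc hypothesis for points in a fundamental domain, restated for all arcs. -/
lemma profile_le_chord_of_arcLen {t : ℝ} (ht : t ∈ Set.Ico 0 T)
    (h0 : ∀ u ∈ Set.Ico (0 : ℝ) (2 * π), ∀ v ∈ Set.Ico (0 : ℝ) (2 * π),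
      F.chord t u v / F.length t
        ≥ a⁻¹ * Real.arctan (a / π * Real.sin (π * F.arcLen t u v / F.length t)))
    {u v : ℝ} (huv : u < v) (hvu : v < u + 2 * π) :
    F.profile a t u v ≤ ‖F.γ v t - F.γ u t‖ := by
  have hL := F.length_pos ht
  have hdom : ∀ u ∈ Set.Ico (0 : ℝ) (2 * π), ∀ v ∈ Set.Ico (0 : ℝ) (2 * π), u < v →
      F.profile a t u v ≤ ‖F.γ v t - F.γ u t‖ := by
    intro u hu v hv huv
    have h1 := h0 u hu v hv
    rw [ge_iff_le, le_div_iff₀ hL, mul_div_assoc, chord, norm_sub_rev] at h1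
    refine le_trans (le_of_eq ?_) h1
    rw [profile, mul_comm]
    congr 1
    rw [arcLen, F.integral_speed ht, abs_of_pos (F.arc_pos ht huv)]
    change chordProfile a _ = chordProfile a _
    rcases min_choice (F.arcCoord t v - F.arcCoord t u)
      (F.length t - (F.arcCoord t v - F.arcCoord t u)) with h | h <;> rw [h]
    rw [sub_div (F.length t), div_self hL.ne', chordProfile_one_sub]
  refine forall_pairs_of_half (P := fun u v => F.profile a t u v ≤ ‖F.γ v t - F.γ u t‖)
    (fun u v => by rw [F.profile_swap ht, F.chord_swap ht]) (fun u hu v hv => ?_) huv hvu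
  have hpi := pi_pos
  rcases lt_or_ge v (2 * π) with h | h
  · exact hdom u hu v ⟨hu.1.trans hv.1.le, h⟩ hv.1
  · have := hdom (v - 2 * π) ⟨by linarith, by linarith [hv.2, hu.2]⟩ u hu (by linarith [hv.2])
    rw [← F.profile_swap ht, ← F.chord_swap ht] at this
    simpa using this

/-- The strict form of the chord-arc comparison, with an exponential slack factor. -/
lemma exp_mul_profile_lt_chord (ha : 0 < a) {ε : ℝ} (hε : 0 < ε)
    (hinit : ∀ u v, u < v → v < u + 2 * π → F.profile a 0 u v ≤ ‖F.γ v 0 - F.γ u 0‖)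
    {t : ℝ} (ht : t ∈ Set.Ico 0 T) {u v : ℝ} (huv : u < v) (hvu : v < u + 2 * π) :
    exp (-ε * (1 + t)) * F.profile a t u v < ‖F.γ v t - F.γ u t‖ := by
  have hpi := pi_pos
  obtain ⟨δ, hδ, hdiag⟩ := exists_near_diagonal (F := F) ha (exp_pos (-ε)).le
    (exp_lt_one_iff.2 (neg_lt_zero.2 hε)) ht
  set Z : (ℝ × ℝ) × ℝ → ℝ := fun p =>
    ‖F.γ p.1.2 p.2 - F.γ p.1.1 p.2‖ - exp (-ε * (1 + p.2)) * F.profile a p.2 p.1.1 p.1.2 with hZ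
  have hZc : ContinuousOn Z (Set.univ ×ˢ Set.Ico 0 T) := by
    have e1 : ContinuousOn (fun p : (ℝ × ℝ) × ℝ => (p.1.1, p.2)) (Set.univ ×ˢ Set.Ico 0 T) := by
      fun_prop
    have e2 : ContinuousOn (fun p : (ℝ × ℝ) × ℝ => (p.1.2, p.2)) (Set.univ ×ˢ Set.Ico 0 T) := by
      fun_prop
    have m1 : Set.MapsTo (fun p : (ℝ × ℝ) × ℝ => (p.1.1, p.2)) (Set.univ ×ˢ Set.Ico 0 T)
        (Set.univ ×ˢ Set.Ico 0 T) := fun p hp => ⟨trivial, hp.2⟩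
    have m2 : Set.MapsTo (fun p : (ℝ × ℝ) × ℝ => (p.1.2, p.2)) (Set.univ ×ˢ Set.Ico 0 T)
        (Set.univ ×ˢ Set.Ico 0 T) := fun p hp => ⟨trivial, hp.2⟩
    have hchord := ((F.continuousOn_γ.comp e2 m2).sub (F.continuousOn_γ.comp e1 m1)).norm
    have hlen : ContinuousOn (fun p : (ℝ × ℝ) × ℝ => F.length p.2) (Set.univ ×ˢ Set.Ico 0 T) :=
      F.continuousOn_length.comp continuousOn_snd fun p hp => hp.2
    have harc := ((F.continuousOn_arcCoord.comp e2 m2).sub (F.continuousOn_arcCoord.comp e1 m1)).div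
      hlen fun p hp => (F.length_pos hp.2).ne'
    have hprofc : Continuous (chordProfile a) :=
      continuous_iff_continuousAt.2 fun σ => (hasDerivAt_chordProfile ha σ).continuousAt
    have hexp : ContinuousOn (fun p : (ℝ × ℝ) × ℝ => exp (-ε * (1 + p.2)))
        (Set.univ ×ˢ Set.Ico 0 T) := by fun_prop
    exact hchord.sub (hexp.mul (hlen.mul (hprofc.comp_continuousOn harc)))
  have hnear : ∀ s ∈ Set.Icc 0 t, ∀ u ∈ Set.Ico 0 (2 * π), ∀ v ∈ Set.Ioo u (u + min δ π),
      0 < Z ((u, v), s) := by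
    intro s hs u hu v hv
    have hs' : s ∈ Set.Ico 0 T := ⟨hs.1, hs.2.trans_lt ht.2⟩
    have h1 := hdiag s hs u ⟨hu.1, hu.2.le⟩ v ⟨hv.1, hv.2.trans_le (by gcongr; exact min_le_left _ _)⟩
    have h2 : exp (-ε * (1 + s)) * F.profile a s u v ≤ exp (-ε) * F.profile a s u v := by
      have := (F.profile_pos hs' ha hv.1 (by linarith [hv.2, min_le_right δ π])).le
      gcongr
      nlinarith [hs.1]
    exact sub_pos.2 (h2.trans_lt h1)
  set K : Set ((ℝ × ℝ) × ℝ) :=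
    (Set.Icc 0 (2 * π) ×ˢ Set.Icc 0 (4 * π)) ×ˢ Set.Icc 0 t ∩
      {p | p.1.1 + min δ π ≤ p.1.2 ∧ p.1.2 ≤ p.1.1 + π} with hK
  have hKc : IsCompact K := ((isCompact_Icc.prod isCompact_Icc).prod isCompact_Icc).inter_right
    ((isClosed_le (f := fun p : (ℝ × ℝ) × ℝ => p.1.1 + min δ π) (g := fun p => p.1.2)
      (by fun_prop) (by fun_prop)).inter (isClosed_le (f := fun p : (ℝ × ℝ) × ℝ => p.1.2)
      (g := fun p => p.1.1 + π) (by fun_prop) (by fun_prop)))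
  have hKsub : K ⊆ Set.univ ×ˢ Set.Ico 0 T := fun p hp =>
    ⟨trivial, hp.1.2.1, hp.1.2.2.trans_lt ht.2⟩
  have hmin0 : 0 < min δ π := by positivity
  have hred : ∀ s ∈ Set.Icc 0 t, (∀ p ∈ K, p.2 = s → 0 < Z p) →
      ∀ u v, u < v → v < u + 2 * π → 0 < Z ((u, v), s) := by
    intro s hs hKs u v huv hvu
    have hs' : s ∈ Set.Ico 0 T := ⟨hs.1, hs.2.trans_lt ht.2⟩
    refine forall_pairs_of_half (P := fun u v => 0 < Z ((u, v), s))
      (fun u v => by simp only [hZ, F.profile_swap hs', F.chord_swap hs']) (fun u hu v hv => ?_)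
      huv hvu
    rcases lt_or_ge v (u + min δ π) with h | h
    · exact hnear s hs u hu v ⟨hv.1, h⟩
    · exact hKs ((u, v), s) ⟨⟨⟨⟨hu.1, hu.2.le⟩, ⟨hu.1.trans hv.1.le, by linarith [hv.2, hu.2]⟩⟩, hs⟩,
        h, hv.2⟩ rfl
  have hB : ∀ p ∈ K, 0 < Z p := by
    by_contra! hbad
    set B := K ∩ Z ⁻¹' Set.Iic 0 with hBdef
    have hBc : IsCompact B :=
      hKc.of_isClosed_subset ((hZc.mono hKsub).preimage_isClosed_of_isClosed hKc.isClosed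
        isClosed_Iic) Set.inter_subset_left
    obtain ⟨p, hpB, hpmin⟩ := hBc.exists_isMinOn (by
      obtain ⟨p, hp, hp'⟩ := hbad
      exact ⟨p, hp, hp'⟩) (continuous_snd.continuousOn (s := B))
    obtain ⟨⟨x, y⟩, s⟩ := p
    have hs : s ∈ Set.Icc 0 t := hpB.1.1.2
    have hs' : s ∈ Set.Ico 0 T := ⟨hs.1, hs.2.trans_lt ht.2⟩
    have hxy : x < y := by
      have : x + min δ π ≤ y := hpB.1.2.1
      linarith
    have hyx : y < x + 2 * π := by
      have : y ≤ x + π := hpB.1.2.2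
      linarith
    have hZle : Z ((x, y), s) ≤ 0 := hpB.2
    have hs0 : 0 < s := by
      rcases hs.1.eq_or_lt with h | h
      · exfalso
        subst h
        have h1 := hinit x y hxy hyx
        have h2 := F.profile_pos hs' ha hxy hyx
        have h3 : exp (-ε * (1 + 0)) < 1 := exp_lt_one_iff.2 (by linarith)
        have h4 := sub_nonpos.1 hZle
        simp only at h4
        nlinarith
      · exact h
    have hbefore : ∀ r, 0 ≤ r → r < s → ∀ u v, u < v → v < u + 2 * π → 0 < Z ((u, v), r) := by
      intro r hr0 hrs
      refine hred r ⟨hr0, hrs.le.trans hs.2⟩ fun p hp hpr => ?_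
      by_contra! hle
      have : s ≤ p.2 := hpmin (show p ∈ B from ⟨hp, hle⟩)
      linarith
    have hslice : ∀ u v, ContinuousWithinAt (fun r => Z ((u, v), r)) (Set.Ico 0 s) s := fun u v =>
      (hZc ((u, v), s) ⟨trivial, hs'⟩).comp (f := fun r : ℝ => ((u, v), r))
        (by fun_prop) fun r hr => ⟨trivial, hr.1, hr.2.trans hs'.2⟩
    have hat : ∀ u v, u < v → v < u + 2 * π → 0 ≤ Z ((u, v), s) := by
      intro u v huv hvu
      have hne : (nhdsWithin s (Set.Ico 0 s)).NeBot := by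
        rw [← mem_closure_iff_nhdsWithin_neBot, closure_Ico hs0.ne]
        exact ⟨hs0.le, le_rfl⟩
      refine ge_of_tendsto (hslice u v) ?_
      filter_upwards [self_mem_nhdsWithin] with r hr
      exact (hbefore r hr.1 hr.2 u v huv hvu).le
    have hzero : Z ((x, y), s) = 0 := le_antisymm hZle (hat x y hxy hyx)
    obtain ⟨d, hd, hder⟩ := hasDerivAt_gap_pos (F := F) ha hε ⟨hs0, hs'.2⟩ hxy hyx
      (sub_eq_zero.1 hzero) (fun p q hpq hqp => sub_nonneg.1 (hat p q hpq hqp))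
    have hne : (nhdsWithin s (Set.Ioo 0 s)).NeBot := by
      rw [← mem_closure_iff_nhdsWithin_neBot, closure_Ioo hs0.ne]
      exact ⟨hs0.le, le_rfl⟩
    have hslope := (hasDerivWithinAt_iff_tendsto_slope' (s := Set.Ioo 0 s)
      (fun h => lt_irrefl _ h.2)).1 hder.hasDerivWithinAt
    have : d ≤ 0 := by
      refine le_of_tendsto hslope ?_
      filter_upwards [self_mem_nhdsWithin] with r hr
      have h1 := hbefore r hr.1.le hr.2 x y hxy hyx
      simp only [hZ] at h1 hzero
      rw [slope_def_field, hzero, sub_zero]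
      exact div_nonpos_of_nonneg_of_nonpos h1.le (by linarith [hr.2])
    linarith
  exact sub_pos.1 (hred t ⟨ht.1, le_rfl⟩ (fun p hp _ => hB p hp) u v huv hvu)

/-- The chord-arc comparison is preserved by the flow. -/
lemma profile_le_chord (ha : 0 < a)
    (hinit : ∀ u v, u < v → v < u + 2 * π → F.profile a 0 u v ≤ ‖F.γ v 0 - F.γ u 0‖)
    {t : ℝ} (ht : t ∈ Set.Ico 0 T) {u v : ℝ} (huv : u < v) (hvu : v < u + 2 * π) :
    F.profile a t u v ≤ ‖F.γ v t - F.γ u t‖ := by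
  have hlim : Filter.Tendsto (fun ε : ℝ => exp (-ε * (1 + t)) * F.profile a t u v)
      (nhdsWithin 0 (Set.Ioi 0)) (nhds (F.profile a t u v)) := by
    have : Continuous fun ε : ℝ => exp (-ε * (1 + t)) * F.profile a t u v := by fun_prop
    have := (this.tendsto 0).mono_left (nhdsWithin_le_nhds (s := Set.Ioi 0))
    simpa using this
  refine le_of_tendsto hlim ?_
  filter_upwards [self_mem_nhdsWithin] with ε hε
  exact (exp_mul_profile_lt_chord ha hε hinit ht huv hvu).le

end ChordArc

section LengthBounds

variable {T a : ℝ} {F : SphereCSF (Set.Ico 0 T)}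
  {c : ℝ → EuclideanSpace ℝ (Fin 3)}

/-- The chord-arc estimate at small scales bounds the curvature. -/
lemma norm_deriv_deriv_sq_le_of_profile_le {t : ℝ} (ht : t ∈ Set.Ico 0 T)
    (ha : 0 < a) (hc : IsSphericalUnitSpeed c) (hγ : ∀ u, F.γ u t = c (F.arcCoord t u))
    (hprof : ∀ u v, u < v → v < u + 2 * π → F.profile a t u v ≤ ‖F.γ v t - F.γ u t‖) (s : ℝ) :
    ‖deriv (deriv c) s‖ ^ 2 ≤ 4 * (π ^ 2 + 2 * a ^ 2) / F.length t ^ 2 := by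
  have hL := F.length_pos ht
  have key : ‖deriv (deriv c) s‖ ^ 2 ≤ 24 * ((π ^ 2 + 2 * a ^ 2) / (6 * F.length t ^ 2)) := by
    refine hc.norm_deriv_deriv_sq_le (by positivity) hL fun x hx => ?_
    obtain ⟨u, hu⟩ := F.arcCoord_surjective ht s
    obtain ⟨v, hv⟩ := F.arcCoord_surjective ht (s + x)
    have huv : u < v := (F.arcCoord_strictMono ht).lt_iff_lt.1 (by linarith [hx.1])
    have hvu : v < u + 2 * π := (F.arcCoord_strictMono ht).lt_iff_lt.1 (by
      rw [F.arcCoord_add_period ht]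
      linarith [hx.2])
    have h1 := hprof u v huv hvu
    rw [hγ u, hγ v, hu, hv, profile, hu, hv, add_sub_cancel_left] at h1
    refine le_trans ?_ h1
    have h2 := sub_cube_le_chordProfile ha (div_nonneg hx.1.le hL.le)
      ((div_le_one hL).2 hx.2.le)
    refine le_trans (le_of_eq ?_) (mul_le_mul_of_nonneg_left h2 hL.le)
    field_simp
  refine key.trans (le_of_eq ?_)
  field_simp
  norm_num

/-- Under the chord-arc estimate the length satisfies `L' = L - K` with
`4π² ≤ L K ≤ 4(π² + 2a²)`. -/
lemma exists_hasDerivAt_length (ha : 0 < a)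
    (hprof : ∀ t ∈ Set.Ico 0 T, ∀ u v, u < v → v < u + 2 * π →
      F.profile a t u v ≤ ‖F.γ v t - F.γ u t‖) {t : ℝ} (ht : t ∈ Set.Ioo 0 T) :
    ∃ K, HasDerivAt F.length (F.length t - K) t ∧ 4 * π ^ 2 ≤ F.length t * K ∧
      F.length t * K ≤ 4 * (π ^ 2 + 2 * a ^ 2) := by
  have ht' : t ∈ Set.Ico 0 T := ⟨ht.1.le, ht.2⟩
  have hL := F.length_pos ht'
  obtain ⟨c, hc, hγ⟩ := F.exists_arclength_param ht'
  refine ⟨_, F.hasDerivAt_length ht hc hγ,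
    hc.four_pi_sq_le hL (F.param_periodic ht' hγ), ?_⟩
  have h1 := intervalIntegral.integral_mono_on (μ := volume)
    (f := fun x => ‖deriv (deriv c) x‖ ^ 2)
    (g := fun _ => 4 * (π ^ 2 + 2 * a ^ 2) / F.length t ^ 2) hL.le
    ((hc.continuous_norm_deriv_deriv.pow 2).intervalIntegrable _ _) intervalIntegrable_const
    (fun x _ => norm_deriv_deriv_sq_le_of_profile_le ht' ha hc hγ (hprof t ht') x)
  rw [intervalIntegral.integral_const, smul_eq_mul, sub_zero] at h1
  refine (mul_le_mul_of_nonneg_left h1 hL.le).trans (le_of_eq ?_)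
  field_simp

lemma hasDerivAt_exp_mul_length_sq_sub {K t : ℝ} (k : ℝ)
    (h : HasDerivAt F.length (F.length t - K) t) :
    HasDerivAt (fun t => exp (-2 * t) * (F.length t ^ 2 - k))
      (exp (-2 * t) * (2 * (k - F.length t * K))) t := by
  have h1 : HasDerivAt (fun t : ℝ => exp (-2 * t)) (exp (-2 * t) * (-2)) t := by
    simpa using ((hasDerivAt_id t).const_mul (-2)).exp
  refine (h1.mul ((h.pow 2).sub_const k)).congr_deriv ?_
  simp only [Pi.pow_apply]
  push_cast
  ring

lemma continuousOn_exp_mul_length_sq_sub (k : ℝ) :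
    ContinuousOn (fun t => exp (-2 * t) * (F.length t ^ 2 - k)) (Set.Ico 0 T) := by
  have := F.continuousOn_length
  fun_prop

lemma tendsto_exp_mul_length_sq_sub (k : ℝ)
    (hL0 : Filter.Tendsto F.length (nhdsWithin T (Set.Iio T)) (nhds 0)) :
    Filter.Tendsto (fun t => exp (-2 * t) * (F.length t ^ 2 - k)) (nhdsWithin T (Set.Iio T))
      (nhds (exp (-2 * T) * (0 ^ 2 - k))) := by
  refine Filter.Tendsto.mul ?_ ((hL0.pow 2).sub_const k)
  exact (by fun_prop : Continuous fun t : ℝ => exp (-2 * t)).continuousWithinAt.tendsto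

/-- If `L' = L - K` with `k ≤ L K` and `L → 0` at `T`, then
`k (1 - e^{-2(T-t)}) ≤ L²`. -/
lemma le_length_sq {k t : ℝ}
    (hL0 : Filter.Tendsto F.length (nhdsWithin T (Set.Iio T)) (nhds 0))
    (hK : ∀ t ∈ Set.Ioo 0 T, ∃ K, HasDerivAt F.length (F.length t - K) t ∧ k ≤ F.length t * K)
    (ht : t ∈ Set.Ico 0 T) : k * (1 - exp (-2 * (T - t))) ≤ F.length t ^ 2 := by
  have hanti : AntitoneOn (fun t => exp (-2 * t) * (F.length t ^ 2 - k)) (Set.Ico 0 T) := by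
    refine antitoneOn_of_deriv_nonpos (convex_Ico 0 T) (continuousOn_exp_mul_length_sq_sub k)
      (fun x hx => ?_) fun x hx => ?_ <;> rw [interior_Ico] at hx <;>
      obtain ⟨K, hd, hk⟩ := hK x hx
    · exact (hasDerivAt_exp_mul_length_sq_sub k hd).differentiableAt.differentiableWithinAt
    · rw [(hasDerivAt_exp_mul_length_sq_sub k hd).deriv]
      exact mul_nonpos_of_nonneg_of_nonpos (exp_pos _).le (by linarith)
  have hlim : exp (-2 * T) * (0 ^ 2 - k) ≤ exp (-2 * t) * (F.length t ^ 2 - k) := by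
    refine le_of_tendsto (tendsto_exp_mul_length_sq_sub k hL0) ?_
    filter_upwards [Ioo_mem_nhdsLT ht.2] with x hx
    exact hanti ht ⟨ht.1.trans hx.1.le, hx.2⟩ hx.1.le
  rw [show -2 * T = -2 * t + -2 * (T - t) by ring, exp_add, mul_assoc] at hlim
  linarith [le_of_mul_le_mul_left hlim (exp_pos _)]

/-- If `L' = L - K` with `L K ≤ k` and `L → 0` at `T`, then
`L² ≤ k (1 - e^{-2(T-t)})`. -/
lemma length_sq_le {k t : ℝ}
    (hL0 : Filter.Tendsto F.length (nhdsWithin T (Set.Iio T)) (nhds 0))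
    (hK : ∀ t ∈ Set.Ioo 0 T, ∃ K, HasDerivAt F.length (F.length t - K) t ∧ F.length t * K ≤ k)
    (ht : t ∈ Set.Ico 0 T) : F.length t ^ 2 ≤ k * (1 - exp (-2 * (T - t))) := by
  have hmono : MonotoneOn (fun t => exp (-2 * t) * (F.length t ^ 2 - k)) (Set.Ico 0 T) := by
    refine monotoneOn_of_deriv_nonneg (convex_Ico 0 T) (continuousOn_exp_mul_length_sq_sub k)
      (fun x hx => ?_) fun x hx => ?_ <;> rw [interior_Ico] at hx <;>
      obtain ⟨K, hd, hk⟩ := hK x hx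
    · exact (hasDerivAt_exp_mul_length_sq_sub k hd).differentiableAt.differentiableWithinAt
    · rw [(hasDerivAt_exp_mul_length_sq_sub k hd).deriv]
      exact mul_nonneg (exp_pos _).le (by linarith)
  have hlim : exp (-2 * t) * (F.length t ^ 2 - k) ≤ exp (-2 * T) * (0 ^ 2 - k) := by
    refine ge_of_tendsto (tendsto_exp_mul_length_sq_sub k hL0) ?_
    filter_upwards [Ioo_mem_nhdsLT ht.2] with x hx
    exact hmono ht ⟨ht.1.trans hx.1.le, hx.2⟩ hx.1.le
  rw [show -2 * T = -2 * t + -2 * (T - t) by ring, exp_add, mul_assoc] at hlim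
  linarith [le_of_mul_le_mul_left hlim (exp_pos _)]

end LengthBounds

end SphereCSF

/-- Length bounds in the finite-time case: for a curve shortening flow of simple closed
spherical curves on `[0,T)` with `T < ∞`, `L(t) → 0` as `t → T`, satisfying the initial
chord-arc hypothesis, one has
`2π√(1 − e^{−2(T−t)}) ≤ L(t) ≤ 2π√((1 + 2a²/π²)(1 − e^{−2(T−t)}))`. -/
theorem finite_time_length_bounds (T : ℝ) (hT : 0 < T)
    (F : SphereCSF (Set.Ico 0 T))
    (hL0 : Filter.Tendsto F.length (nhdsWithin T (Set.Iio T)) (nhds 0))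
    (a : ℝ) (ha : 0 < a)
    (h0 : ∀ u ∈ Set.Ico (0 : ℝ) (2 * π), ∀ v ∈ Set.Ico (0 : ℝ) (2 * π),
      F.chord 0 u v / F.length 0
        ≥ a⁻¹ * Real.arctan (a / π * Real.sin (π * F.arcLen 0 u v / F.length 0)))
    (t : ℝ) (ht : t ∈ Set.Ico (0 : ℝ) T) :
    2 * π * Real.sqrt (1 - Real.exp (-2 * (T - t))) ≤ F.length t ∧
    F.length t ≤ 2 * π * Real.sqrt ((1 + 2 * a ^ 2 / π ^ 2) * (1 - Real.exp (-2 * (T - t)))) := by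
  have hL := F.length_pos ht
  have hinit : ∀ u v, u < v → v < u + 2 * π → F.profile a 0 u v ≤ ‖F.γ v 0 - F.γ u 0‖ :=
    fun u v huv hvu => F.profile_le_chord_of_arcLen ⟨le_rfl, hT⟩ h0 huv hvu
  have hK := fun s (hs : s ∈ Set.Ioo 0 T) => F.exists_hasDerivAt_length ha
    (fun r hr u v huv hvu => F.profile_le_chord ha hinit hr huv hvu) hs
  have hlow := SphereCSF.le_length_sq hL0
    (fun s hs => (hK s hs).imp fun K h => ⟨h.1, h.2.1⟩) ht
  have hupp := SphereCSF.length_sq_le hL0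
    (fun s hs => (hK s hs).imp fun K h => ⟨h.1, h.2.2⟩) ht
  have h2 : ∀ x, 2 * π * √x = √(4 * π ^ 2 * x) := fun x => by
    rw [Real.sqrt_mul (by positivity), show 4 * π ^ 2 = (2 * π) ^ 2 by ring,
      Real.sqrt_sq (by positivity)]
  rw [h2, h2]
  refine ⟨Real.sqrt_le_iff.2 ⟨hL.le, hlow⟩, Real.le_sqrt_of_sq_le (hupp.trans (le_of_eq ?_))⟩
  field_simp

end
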